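/- arXiv:1410.2442 — 4 statements merged into one kernel-verified Lean document; each statement's English description precedes it below -/
import Mathlib

section
/- Let A : Fin m → Set (ℝ^d) be a family of nonempty regular closed subsets of a Euclidean space ℝ^d such that for all i ≠ j one of EC(A i, A j), DC(A i, A j), NTPP(A i, A j), NTPP(A j, A i) holds. Then there exists a family B : Fin m → Set ℝ³ of nonempty convex regular closed subsets of ℝ³ such that for all i ≠ j, EC(B i, B j) holds iff EC(A i, A j) holds, DC(B i, B j) holds iff DC(A i, A j) holds, and NTPP(B i, B j) holds iff NTPP(A i, A j) holds. (Every consistent atomic RCC8 network over {EC, DC, NTPP, NTPP⁻¹} has a convex solution in ℝ³.) -/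
/-- A set is regular closed if it equals the closure of its interior. -/
def RegClosed {α : Type*} [TopologicalSpace α] (X : Set α) : Prop :=
  closure (interior X) = X

/-- RCC8: disconnected. -/
def DC {α : Type*} (a b : Set α) : Prop := a ∩ b = ∅

/-- RCC8: externally connected. -/
def EC {α : Type*} [TopologicalSpace α] (a b : Set α) : Prop :=
  (a ∩ b).Nonempty ∧ interior a ∩ interior b = ∅

/-- RCC8: partially overlaps. -/
def PO {α : Type*} [TopologicalSpace α] (a b : Set α) : Prop :=
  (interior a ∩ interior b).Nonempty ∧ ¬ a ⊆ b ∧ ¬ b ⊆ a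

/-- RCC8: tangential proper part. -/
def TPP {α : Type*} [TopologicalSpace α] (a b : Set α) : Prop :=
  a ⊂ b ∧ ¬ a ⊆ interior b

/-- RCC8: non-tangential proper part. -/
def NTPP {α : Type*} [TopologicalSpace α] (a b : Set α) : Prop :=
  a ⊆ interior b ∧ a ≠ b

/-- RCC5: discrete from. -/
def DR {α : Type*} [TopologicalSpace α] (a b : Set α) : Prop :=
  interior a ∩ interior b = ∅

/-- RCC5: proper part. -/
def PP {α : Type*} (a b : Set α) : Prop := a ⊂ b

open Metric

lemma RegClosed.interior_nonempty {α : Type*} [TopologicalSpace α] {X : Set α}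
    (hX : RegClosed X) (hne : X.Nonempty) : (interior X).Nonempty := by
  rw [← closure_nonempty_iff, hX]
  exact hne

lemma RegClosed.disjoint_right {α : Type*} [TopologicalSpace α] {U X : Set α}
    (hX : RegClosed X) (hU : IsOpen U) (h : Disjoint U (interior X)) : Disjoint U X := by
  rw [← hX]
  exact h.closure_right hU

lemma EC.symm {α : Type*} [TopologicalSpace α] {a b : Set α} (h : EC a b) : EC b a :=
  ⟨Set.inter_comm a b ▸ h.1, Set.inter_comm (interior a) (interior b) ▸ h.2⟩

lemma EC.disjoint_interior {α : Type*} [TopologicalSpace α] {a b : Set α} (h : EC a b)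
    (hb : RegClosed b) : Disjoint (interior a) b :=
  hb.disjoint_right isOpen_interior (Set.disjoint_iff_inter_eq_empty.2 h.2)

lemma EC.not_DC {α : Type*} [TopologicalSpace α] {a b : Set α} (h : EC a b) : ¬ DC a b :=
  h.1.ne_empty

lemma EC.not_subset_interior {α : Type*} [TopologicalSpace α] {a b : Set α} (h : EC a b)
    (ha : (interior a).Nonempty) : ¬ a ⊆ interior b := fun hab => by
  obtain ⟨x, hx⟩ := ha
  have : x ∈ interior a ∩ interior b := ⟨hx, hab (interior_subset hx)⟩
  rw [h.2] at this
  exact this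

lemma DC.not_subset_interior {α : Type*} [TopologicalSpace α] {a b : Set α} (h : DC a b)
    (ha : (interior a).Nonempty) : ¬ a ⊆ interior b := fun hab => by
  obtain ⟨x, hx⟩ := ha
  have hxa := interior_subset hx
  have : x ∈ a ∩ b := ⟨hxa, interior_subset (hab hxa)⟩
  rw [DC] at h
  rw [h] at this
  exact this

lemma DC.symm {α : Type*} {a b : Set α} (h : DC a b) : DC b a :=
  (Set.inter_comm b a).trans h

lemma NTPP.not_NTPP {α : Type*} [TopologicalSpace α] {a b : Set α} (h : NTPP a b) :
    ¬ NTPP b a := fun h' =>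
  h.2 ((h.1.trans interior_subset).antisymm (h'.1.trans interior_subset))

lemma NTPP.trans {α : Type*} [TopologicalSpace α] {a b c : Set α} (h : NTPP a b)
    (h' : NTPP b c) : NTPP a c := by
  refine ⟨(h.1.trans interior_subset).trans h'.1, ?_⟩
  rintro rfl
  exact h.not_NTPP h'

lemma EC.image {α β : Type*} [TopologicalSpace α] [TopologicalSpace β] {a b : Set α}
    (h : EC a b) (φ : α ≃ₜ β) : EC (φ '' a) (φ '' b) := by
  constructor
  · rw [← Set.image_inter φ.injective]
    exact h.1.image _
  · rw [← φ.image_interior, ← φ.image_interior, ← Set.image_inter φ.injective, h.2,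
      Set.image_empty]

lemma DC.image {α β : Type*} {a b : Set α} (h : DC a b) {φ : α → β}
    (hφ : Function.Injective φ) : DC (φ '' a) (φ '' b) := by
  rw [DC, ← Set.image_inter hφ, show a ∩ b = ∅ from h, Set.image_empty]

/-- A closed convex subset of the closed ball of radius `R` with nonempty interior. -/
structure IsBodyIn {V : Type*} [NormedAddCommGroup V] [NormedSpace ℝ V] (R : ℝ) (X : Set V) :
    Prop where
  convex : Convex ℝ X
  isClosed : IsClosed X
  interior_nonempty : (interior X).Nonempty
  subset_closedBall : X ⊆ closedBall 0 R

lemma IsBodyIn.regClosed {V : Type*} [NormedAddCommGroup V] [NormedSpace ℝ V] {R : ℝ}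
    {X : Set V} (h : IsBodyIn R X) : RegClosed X :=
  (h.convex.closure_interior_eq_closure_of_nonempty_interior h.interior_nonempty).trans
    h.isClosed.closure_eq

lemma IsBodyIn.ntpp {V : Type*} [NormedAddCommGroup V] [NormedSpace ℝ V] [Nontrivial V] {R : ℝ}
    {X Y : Set V} (h : IsBodyIn R X) (hXY : X ⊆ interior Y) : NTPP X Y := by
  refine ⟨hXY, ?_⟩
  rintro rfl
  have hopen : IsOpen X := subset_interior_iff_isOpen.1 hXY
  rcases isClopen_iff.1 ⟨h.isClosed, hopen⟩ with hX | hX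
  · simpa [hX] using h.interior_nonempty
  · exact NormedSpace.unbounded_univ ℝ V (hX ▸ isBounded_closedBall.subset h.subset_closedBall)

/-- A ball can be shrunk affinely into any set with nonempty interior. -/
lemma exists_homeomorph_image_closedBall_subset {V : Type*} [NormedAddCommGroup V]
    [NormedSpace ℝ V] {R : ℝ} (hR : 0 < R) {X : Set V} (hX : (interior X).Nonempty) :
    ∃ φ : V ≃ₜ V, (∀ s, Convex ℝ s → Convex ℝ (φ '' s)) ∧
      φ '' closedBall 0 R ⊆ interior X := by
  obtain ⟨c, hc⟩ := hX
  obtain ⟨ε, hε, hball⟩ := Metric.isOpen_iff.1 isOpen_interior c hc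
  have hr : 0 < ε / (2 * R) := by positivity
  refine ⟨(Homeomorph.smulOfNeZero (ε / (2 * R)) hr.ne').trans (Homeomorph.addLeft c), ?_, ?_⟩
  · intro s hs
    have := (hs.smul (ε / (2 * R))).translate c
    rwa [← Set.image_smul, Set.image_image] at this
  · rintro _ ⟨y, hy, rfl⟩
    apply hball
    rw [mem_closedBall_zero_iff] at hy
    have : ‖(ε / (2 * R)) • y‖ < ε := by
      rw [norm_smul, Real.norm_of_nonneg hr.le]
      calc ε / (2 * R) * ‖y‖ ≤ ε / (2 * R) * R := by gcongr
        _ = ε / 2 := by field_simp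
        _ < ε := by linarith
    simpa [mem_ball, dist_eq_norm] using this

/-- `B` realizes on `S` the network with part relation `L` and contact relation `E`. -/
structure Realizes {ι V : Type*} [NormedAddCommGroup V] [NormedSpace ℝ V] (R : ℝ)
    (L E : ι → ι → Prop) (S : Set ι) (B : ι → Set V) : Prop where
  body : ∀ i ∈ S, IsBodyIn R (B i)
  part : ∀ i ∈ S, ∀ j ∈ S, L i j → B i ⊆ interior (B j)
  contact : ∀ i ∈ S, ∀ j ∈ S, i ≠ j → E i j → EC (B i) (B j)
  apart : ∀ i ∈ S, ∀ j ∈ S, i ≠ j → ¬ E i j → ¬ L i j → ¬ L j i → DC (B i) (B j)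

lemma exists_mem_forall_not_rel {ι : Type*} {L : ι → ι → Prop} (hirr : ∀ i, ¬ L i i)
    (htrans : ∀ i j k, L i j → L j k → L i k) {T : Finset ι} (hT : T.Nonempty) :
    ∃ t ∈ T, ∀ k ∈ T, ¬ L t k := by
  have : IsStrictOrder ι (Function.swap L) :=
    { irrefl := hirr, trans := fun i j k hij hjk => htrans k j i hjk hij }
  obtain ⟨t, ht, hmax⟩ := (T.finite_toSet.wellFoundedOn (r := Function.swap L)).has_min
    Set.univ ⟨⟨hT.choose, hT.choose_spec⟩, trivial⟩
  exact ⟨t, t.2, fun k hk => hmax ⟨k, hk⟩ trivial⟩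

/-- A family realizing all contact relations, ignoring the part relation, can be nested to
realize a forest-like part relation. -/
lemma exists_realizes {ι V : Type*} [NormedAddCommGroup V] [NormedSpace ℝ V] {R : ℝ} (hR : 0 < R)
    {L E : ι → ι → Prop} (hirr : ∀ i, ¬ L i i) (htrans : ∀ i j k, L i j → L j k → L i k)
    (hsymm : ∀ i j, E i j → E j i)
    (hforest : ∀ i j k, L i j → L i k → j ≠ k → L j k ∨ L k j)
    (hsib : ∀ i j k, E i j → L i k → L j k)
    {C : ι → Set V} (hC : ∀ i, IsBodyIn R (C i))
    (hcontact : ∀ i j, i ≠ j → E i j → EC (C i) (C j))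
    (hapart : ∀ i j, i ≠ j → ¬ E i j → DC (C i) (C j)) (S : Finset ι) :
    ∃ B : ι → Set V, Realizes R L E S B := by
  classical
  induction S using Finset.strongInduction with
  | H S ih =>
    have hsub : ∀ i, i ∈ S → ∃ B : ι → Set V, Realizes R L E (S.filter (L · i)) B :=
      fun i hi => ih _ (Finset.filter_ssubset.2 ⟨i, hi, hirr i⟩)
    choose! D hD using hsub
    choose φ hφc hφ using fun i =>
      exists_homeomorph_image_closedBall_subset hR (hC i).interior_nonempty
    have hmem : ∀ i ∈ S, ∀ j ∈ S, L j i → j ∈ (S.filter (L · i) : Set ι) := by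
      intro i _ j hj h
      simp [hj, h]
    have hint : ∀ i j, i ≠ j → Disjoint (interior (C i)) (C j) := by
      intro i j hij
      by_cases hE : E i j
      · exact (hcontact i j hij hE).disjoint_interior (hC j).regClosed
      · exact (Set.disjoint_iff_inter_eq_empty.2 (hapart i j hij hE)).mono_left interior_subset
    let M : ι → Prop := fun i => ∀ k ∈ S, ¬ L i k
    have htop : ∀ j ∈ S, ¬ M j → ∃ i ∈ S, L j i ∧ M i := by
      intro j _ hj
      by_contra! hcon
      obtain ⟨k, hk, hjk⟩ : ∃ k ∈ S, L j k := by simpa [M] using hj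
      obtain ⟨t, ht, hmax⟩ := exists_mem_forall_not_rel hirr htrans (T := S.filter (L j ·))
        ⟨k, Finset.mem_filter.2 ⟨hk, hjk⟩⟩
      rw [Finset.mem_filter] at ht
      exact hcon t ht.1 ht.2 fun k hk htk =>
        hmax k (Finset.mem_filter.2 ⟨hk, htrans _ _ _ ht.2 htk⟩) htk
    choose! top htopS htopL htopM using htop
    let B : ι → Set V := fun j => if M j then C j else φ (top j) '' D (top j) j
    have hBM : ∀ j, M j → B j = C j := fun j h => if_pos h
    have hBN : ∀ j, ¬ M j → B j = φ (top j) '' D (top j) j := fun j h => if_neg h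
    have hDbody : ∀ j ∈ S, ¬ M j → IsBodyIn R (D (top j) j) := fun j hj h =>
      (hD _ (htopS j hj h)).body j (hmem _ (htopS j hj h) j hj (htopL j hj h))
    have hBsub : ∀ j ∈ S, ¬ M j → B j ⊆ interior (C (top j)) := fun j hj h => by
      rw [hBN j h]
      exact (Set.image_mono (hDbody j hj h).subset_closedBall).trans (hφ _)
    have huniq : ∀ j ∈ S, ¬ M j → ∀ k ∈ S, M k → L j k → k = top j := by
      intro j hj h k hk hkM hjk
      by_contra hne
      rcases hforest j k (top j) hjk (htopL j hj h) hne with h' | h'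
      · exact hkM _ (htopS j hj h) h'
      · exact htopM j hj h _ hk h'
    refine ⟨B, ⟨?_, ?_, ?_, ?_⟩⟩
    · intro j hj
      by_cases h : M j
      · rw [hBM j h]; exact hC j
      · have hb := hDbody j hj h
        refine ⟨?_, ?_, ?_, ((hBsub j hj h).trans interior_subset).trans
          (hC _).subset_closedBall⟩ <;> rw [hBN j h]
        · exact hφc _ _ hb.convex
        · exact (φ _).isClosedMap _ hb.isClosed
        · rw [← (φ _).image_interior]
          exact hb.interior_nonempty.image _
    · intro j hj k hk hjk
      have h : ¬ M j := fun h => h k hk hjk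
      by_cases h' : M k
      · rw [hBM k h', huniq j hj h k hk h' hjk]
        exact hBsub j hj h
      · have heq : top k = top j := huniq j hj h _ (htopS k hk h') (htopM k hk h')
          (htrans _ _ _ hjk (htopL k hk h'))
        rw [hBN j h, hBN k h', heq, ← (φ _).image_interior]
        have hS := htopS j hj h
        exact Set.image_mono ((hD _ hS).part j (hmem _ hS j hj (htopL j hj h)) k
          (hmem _ hS k hk (heq ▸ htopL k hk h')) hjk)
    · intro j hj k hk hne hE
      have hiff : ∀ l, L j l ↔ L k l := fun l => ⟨hsib j k l hE, hsib k j l (hsymm _ _ hE)⟩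
      by_cases h : M j
      · have h' : M k := fun l hl hkl => h l hl ((hiff l).2 hkl)
        rw [hBM j h, hBM k h']
        exact hcontact j k hne hE
      · have h' : ¬ M k := fun h' => h fun l hl hjl => h' l hl ((hiff l).1 hjl)
        have heq : top k = top j := huniq j hj h _ (htopS k hk h') (htopM k hk h')
          ((hiff _).2 (htopL k hk h'))
        have hS := htopS j hj h
        rw [hBN j h, hBN k h', heq]
        exact ((hD _ hS).contact j (hmem _ hS j hj (htopL j hj h)) k
          (hmem _ hS k hk (heq ▸ htopL k hk h')) hne hE).image _
    · intro j hj k hk hne hE hjk hkj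
      by_cases h : M j <;> by_cases h' : M k
      · rw [hBM j h, hBM k h']
        exact hapart j k hne hE
      · have hne' : top k ≠ j := fun e => hkj (e ▸ htopL k hk h')
        rw [hBM j h]
        exact Set.disjoint_iff_inter_eq_empty.1
          ((hint _ _ hne').mono_left (hBsub k hk h')).symm
      · have hne' : top j ≠ k := fun e => hjk (e ▸ htopL j hj h)
        rw [hBM k h']
        exact Set.disjoint_iff_inter_eq_empty.1
          ((hint _ _ hne').mono_left (hBsub j hj h))
      · by_cases heq : top k = top j
        · have hS := htopS j hj h
          rw [hBN j h, hBN k h', heq]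
          exact ((hD _ hS).apart j (hmem _ hS j hj (htopL j hj h)) k
            (hmem _ hS k hk (heq ▸ htopL k hk h')) hne hE hjk hkj).image (φ _).injective
        · exact Set.disjoint_iff_inter_eq_empty.1
            ((hint _ _ (Ne.symm heq)).mono (hBsub j hj h)
              ((hBsub k hk h').trans interior_subset))

/-- The value at `t` of the quartic `-t⁴ + x₂ t³ + x₁ t² + x₀ t`. -/
def quartic (t : ℝ) (x : EuclideanSpace ℝ (Fin 3)) : ℝ :=
  -t ^ 4 + x 0 * t + x 1 * t ^ 2 + x 2 * t ^ 3

/-- The point for which `quartic` attains its maximum over `t` exactly at `s` and `u`. -/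
def tangencyPoint (s u : ℝ) : EuclideanSpace ℝ (Fin 3) :=
  !₂[2 * s * u * (s + u), -((s + u) ^ 2 + 2 * s * u), 2 * (s + u)]

lemma quartic_tangencyPoint (s u t : ℝ) :
    quartic t (tangencyPoint s u) = s ^ 2 * u ^ 2 - ((t - s) * (t - u)) ^ 2 := by
  simp [quartic, tangencyPoint]
  ring

lemma continuous_quartic (t : ℝ) : Continuous (quartic t) := by
  unfold quartic
  fun_prop

/-- Every graph on `Fin m` is the contact graph of a family of convex bodies in space. -/
lemma exists_contact_bodies {m : ℕ} (E : Fin m → Fin m → Prop) (hsymm : ∀ i j, E i j → E j i) :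
    ∃ R : ℝ, 0 < R ∧ ∃ C : Fin m → Set (EuclideanSpace ℝ (Fin 3)),
      (∀ i, IsBodyIn R (C i)) ∧ (∀ i j, i ≠ j → E i j → EC (C i) (C j)) ∧
      (∀ i j, i ≠ j → ¬ E i j → DC (C i) (C j)) := by
  classical
  let v : Fin m → ℝ := fun i => (i : ℕ)
  let p : Fin m → Fin m → EuclideanSpace ℝ (Fin 3) := fun i j => tangencyPoint (v i) (v j)
  have hv : ∀ i j, i ≠ j → 1 ≤ (v i - v j) ^ 2 := by
    intro i j hij
    have h : ((i : ℕ) : ℤ) - (j : ℕ) ≠ 0 := by omega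
    have := Int.one_le_abs h
    have h2 : (1 : ℤ) ≤ (((i : ℕ) : ℤ) - (j : ℕ)) ^ 2 := by
      rw [← sq_abs]; nlinarith
    simp only [v]
    exact_mod_cast h2
  obtain ⟨R, hR, hpR⟩ : ∃ R : ℝ, 0 < R ∧ ∀ i j, p i j ∈ ball 0 R := by
    have hb := (Set.finite_range fun q : Fin m × Fin m => p q.1 q.2).isBounded
    obtain ⟨R, hR, h⟩ := hb.subset_ball_lt 0 0
    exact ⟨R, hR, fun i j => h ⟨(i, j), rfl⟩⟩
  let w : Fin m → Fin m → ℝ := fun i j => if E i j then 0 else 1 / 2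
  let C : Fin m → Set (EuclideanSpace ℝ (Fin 3)) := fun i =>
    closedBall 0 R ∩ ⋂ j, ⋂ _ : i ≠ j, {x | quartic (v j) x + w i j ≤ quartic (v i) x}
  have hmemC : ∀ i x, x ∈ C i ↔ x ∈ closedBall 0 R ∧
      ∀ j, i ≠ j → quartic (v j) x + w i j ≤ quartic (v i) x := by
    intro i x
    simp [C]
  have hw : ∀ i j, w i j ≤ 1 / 2 := by
    intro i j
    simp only [w]
    split_ifs <;> norm_num
  have hpC : ∀ i j, E i j → p i j ∈ C i := by
    intro i j hij
    refine (hmemC _ _).2 ⟨ball_subset_closedBall (hpR i j), fun k hik => ?_⟩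
    simp only [p, quartic_tangencyPoint]
    by_cases hjk : j = k
    · subst hjk
      simp [w, hij]
    · have h1 := hv k i (Ne.symm hik)
      have h2 := hv k j (Ne.symm hjk)
      have := hw i k
      rw [mul_pow]
      nlinarith
  refine ⟨R, hR, C, ?_, ?_, ?_⟩
  · intro i
    refine ⟨?_, ?_, ?_, Set.inter_subset_left⟩
    · refine (convex_closedBall _ _).inter
        (convex_iInter fun j => convex_iInter fun _ => ?_)
      intro x hx y hy a b ha hb hab
      simp only [Set.mem_ofPred_eq, quartic, PiLp.add_apply, PiLp.smul_apply, smul_eq_mul] at *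
      obtain rfl : b = 1 - a := by linarith
      nlinarith [mul_le_mul_of_nonneg_left hx ha, mul_le_mul_of_nonneg_left hy hb]
    · refine isClosed_closedBall.inter
        (isClosed_iInter fun j => isClosed_iInter fun _ => isClosed_le ?_ ?_)
      · exact (continuous_quartic _).add continuous_const
      · exact continuous_quartic _
    · have hopen : IsOpen (ball 0 R ∩
          ⋂ j, ⋂ _ : i ≠ j, {x | quartic (v j) x + w i j < quartic (v i) x}) :=
        isOpen_ball.inter (isOpen_iInter_of_finite fun j => isOpen_iInter_of_finite fun _ =>
          isOpen_lt ((continuous_quartic _).add continuous_const) (continuous_quartic _))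
      refine ⟨p i i, interior_maximal ?_ hopen ?_⟩
      · exact Set.inter_subset_inter ball_subset_closedBall
          (Set.iInter_mono fun j => Set.iInter_mono fun _ x hx => by
            rw [Set.mem_ofPred_eq] at hx ⊢
            exact hx.le)
      · refine ⟨hpR i i, ?_⟩
        simp only [Set.mem_iInter, Set.mem_ofPred_eq, p, quartic_tangencyPoint]
        intro j hij
        have h1 := hv j i (Ne.symm hij)
        have := hw i j
        rw [mul_pow]
        nlinarith
  · intro i j hij hE
    refine ⟨⟨p i j, hpC i j hE, ?_⟩, ?_⟩
    · have hcomm : p i j = p j i := by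
        simp only [p, tangencyPoint]
        congr 3 <;> ring_nf
      rw [hcomm]
      exact hpC j i (hsymm _ _ hE)
    · have heq : ∀ x ∈ interior (C i) ∩ interior (C j), quartic (v i) x = quartic (v j) x := by
        rintro x ⟨hx, hx'⟩
        have h1 := ((hmemC _ _).1 (interior_subset hx)).2 j hij
        have h2 := ((hmemC _ _).1 (interior_subset hx')).2 i (Ne.symm hij)
        simp only [w, hE, hsymm _ _ hE, if_true] at h1 h2
        linarith
      by_contra hne
      obtain ⟨x, hx⟩ := Set.nonempty_iff_ne_empty.2 hne
      have hU := (isOpen_interior.inter isOpen_interior).mem_nhds hx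
      have hcont : Continuous fun s : ℝ => x + s • EuclideanSpace.single (0 : Fin 3) (1 : ℝ) := by
        fun_prop
      have hev := hcont.continuousAt.preimage_mem_nhds (x := 0)
        (by rwa [zero_smul, add_zero])
      obtain ⟨δ, hδ, hball⟩ := Metric.mem_nhds_iff.1 hev
      have hs := heq _ (hball (show δ / 2 ∈ ball (0 : ℝ) δ by
        rw [mem_ball_zero_iff, Real.norm_of_nonneg (by positivity)]; linarith))
      have h0 := heq x hx
      simp [quartic] at hs h0
      have hz : δ / 2 * (v i - v j) = 0 := by linarith
      have := hv i j hij
      rcases mul_eq_zero.1 hz with h | h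
      · linarith
      · rw [h] at this
        norm_num at this
  · intro i j hij hE
    have hE' : ¬ E j i := fun h => hE (hsymm _ _ h)
    refine Set.eq_empty_of_forall_notMem fun x hx => ?_
    have h1 := ((hmemC _ _).1 hx.1).2 j hij
    have h2 := ((hmemC _ _).1 hx.2).2 i (Ne.symm hij)
    simp only [w, hE, hE', if_false] at h1 h2
    linarith

/-- Every consistent atomic RCC8 network over {EC, DC, NTPP, NTPP⁻¹} has a convex
solution in ℝ³. -/
theorem statement13 (m d : ℕ) (A : Fin m → Set (EuclideanSpace ℝ (Fin d)))
    (hA : ∀ i, (A i).Nonempty ∧ RegClosed (A i))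
    (hrel : ∀ i j : Fin m, i ≠ j →
      EC (A i) (A j) ∨ DC (A i) (A j) ∨ NTPP (A i) (A j) ∨ NTPP (A j) (A i)) :
    ∃ B : Fin m → Set (EuclideanSpace ℝ (Fin 3)),
      (∀ i, (B i).Nonempty ∧ Convex ℝ (B i) ∧ RegClosed (B i)) ∧
      (∀ i j : Fin m, i ≠ j →
        (EC (B i) (B j) ↔ EC (A i) (A j)) ∧
        (DC (B i) (B j) ↔ DC (A i) (A j)) ∧
        (NTPP (B i) (B j) ↔ NTPP (A i) (A j))) := by
  have hint : ∀ i, (interior (A i)).Nonempty := fun i =>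
    (hA i).2.interior_nonempty (hA i).1
  have hmeet : ∀ i j, i ≠ j → (interior (A i) ∩ A j).Nonempty →
      NTPP (A i) (A j) ∨ NTPP (A j) (A i) := by
    intro i j hij hne
    rcases hrel i j hij with h | h | h | h
    · exact absurd (h.disjoint_interior (hA j).2) (Set.not_disjoint_iff_nonempty_inter.2 hne)
    · exact absurd h (hne.mono (Set.inter_subset_inter_left _ interior_subset)).ne_empty
    · exact Or.inl h
    · exact Or.inr h
  obtain ⟨R, hR, C, hC, hcontact, hapart⟩ :=
    exists_contact_bodies (fun i j => EC (A i) (A j)) fun _ _ => EC.symm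
  obtain ⟨B, hB⟩ := exists_realizes (L := fun i j => NTPP (A i) (A j)) hR
    (fun i h => h.2 rfl) (fun _ _ _ => NTPP.trans) (fun _ _ => EC.symm)
    (by
      intro i j k hij hik hjk
      obtain ⟨x, hx⟩ := (hA i).1
      exact hmeet j k hjk ⟨x, hij.1 hx, interior_subset (hik.1 hx)⟩)
    (by
      intro i j k hE hik
      have hjk : k ≠ j := by
        rintro rfl
        exact hE.not_subset_interior (hint i) hik.1
      obtain ⟨x, hxi, hxj⟩ := hE.1
      rcases hmeet k j hjk ⟨x, hik.1 hxi, hxj⟩ with h | h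
      · exact absurd (hik.trans h).1 (hE.not_subset_interior (hint i))
      · exact h)
    hC hcontact hapart Finset.univ
  have hbody : ∀ i, IsBodyIn R (B i) := fun i => hB.body i (by simp)
  refine ⟨B, fun i => ⟨(hbody i).interior_nonempty.mono interior_subset, (hbody i).convex,
    (hbody i).regClosed⟩, fun i j hij => ?_⟩
  have hBi := (hbody i).interior_nonempty
  have hBj := (hbody j).interior_nonempty
  rcases hrel i j hij with h | h | h | h
  · have h' : EC (B i) (B j) := hB.contact i (by simp) j (by simp) hij h
    exact ⟨iff_of_true h' h, iff_of_false h'.not_DC h.not_DC,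
      iff_of_false (fun k => h'.not_subset_interior hBi k.1)
        (fun k => h.not_subset_interior (hint i) k.1)⟩
  · have hn : ¬ NTPP (A i) (A j) := fun k => h.not_subset_interior (hint i) k.1
    have h' : DC (B i) (B j) := hB.apart i (by simp) j (by simp) hij (fun k => k.not_DC h) hn
      (fun k => h.symm.not_subset_interior (hint j) k.1)
    exact ⟨iff_of_false (fun k => k.not_DC h') (fun k => k.not_DC h), iff_of_true h' h,
      iff_of_false (fun k => h'.not_subset_interior hBi k.1) hn⟩
  · have h' : NTPP (B i) (B j) := (hbody i).ntpp (hB.part i (by simp) j (by simp) h)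
    exact ⟨iff_of_false (fun k => k.not_subset_interior hBi h'.1)
        (fun k => k.not_subset_interior (hint i) h.1),
      iff_of_false (fun k => k.not_subset_interior hBi h'.1)
        (fun k => k.not_subset_interior (hint i) h.1), iff_of_true h' h⟩
  · have h' : NTPP (B j) (B i) := (hbody j).ntpp (hB.part j (by simp) i (by simp) h)
    exact ⟨iff_of_false (fun k => k.symm.not_subset_interior hBj h'.1)
        (fun k => k.symm.not_subset_interior (hint j) h.1),
      iff_of_false (fun k => k.symm.not_subset_interior hBj h'.1)
        (fun k => k.symm.not_subset_interior (hint j) h.1),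
      iff_of_false h'.not_NTPP h.not_NTPP⟩
end

section
/- There exist a natural number m, a dimension d, and a family A : Fin m → Set (ℝ^d) of nonempty regular closed subsets of ℝ^d such that for all i ≠ j one of EC(A i, A j), DC(A i, A j), TPP(A i, A j), TPP(A j, A i) holds, and such that there is no family B : Fin m → Set ℝ³ of nonempty convex regular closed subsets of ℝ³ with, for all i ≠ j: EC(B i, B j) iff EC(A i, A j), DC(B i, B j) iff DC(A i, A j), and TPP(B i, B j) iff TPP(A i, A j). (There is a consistent atomic RCC8 network over {EC, DC, TPP, TPP⁻¹} with no convex solution in ℝ³.) -/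
/-- If two segments join the same two rays from the origin and their order along the two rays
differs, then they meet. -/
theorem inter_nonempty_of_radial_swap {V : Type*} [AddCommGroup V] [Module ℝ V] {K L : Set V}
    (hK : Convex ℝ K) (hL : Convex ℝ L) {a b : V} {k l : ℝ} (ha : a ∈ K) (hb : b ∈ K)
    (hka : k • a ∈ L) (hlb : l • b ∈ L) (hk : 1 ≤ k) (hl0 : 0 ≤ l) (hl : l ≤ 1) :
    (K ∩ L).Nonempty := by
  rcases eq_or_lt_of_le hk with rfl | hk
  · exact ⟨a, ha, by simpa using hka⟩
  have hkl : 0 < k - l := by linarith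
  obtain ⟨w, hw⟩ : ∃ w, w = (1 - l) / (k - l) := ⟨_, rfl⟩
  have hwk : w * (k - l) = 1 - l := by rw [hw]; field_simp
  have hw0 : 0 ≤ w := hw ▸ div_nonneg (by linarith) hkl.le
  have hw1 : 0 ≤ 1 - w := by
    rw [hw, sub_nonneg, div_le_one hkl]
    linarith
  refine ⟨(w * k) • a + ((1 - w) * l) • b,
    hK ha hb (by positivity) (by positivity) (by linarith), ?_⟩
  rw [mul_smul, mul_smul]
  exact hL hka hlb hw0 hw1 (by ring)

theorem exists_pos_smul_mem_of_cross_nonneg {V : Type*} [AddCommGroup V] [Module ℝ V] {p : Set V}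
    (hp : Convex ℝ p) {e f : V} {s x y x' y' : ℝ} (hs : 0 < s) (hy : 0 < y) (hy' : 0 < y')
    (hsp : s • e ∈ p) (hap : x' • e + y' • f ∈ p) (hc : 0 ≤ x * y' - y * x') :
    ∃ k : ℝ, 0 < k ∧ k • (x • e + y • f) ∈ p := by
  have hD : 0 < x * y' - y * x' + y * s := by positivity
  refine ⟨s * y' / (x * y' - y * x' + y * s), by positivity, ?_⟩
  have key := hp hsp hap (a := (x * y' - y * x') / (x * y' - y * x' + y * s))
    (b := y * s / (x * y' - y * x' + y * s)) (by positivity) (by positivity) (by field_simp)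
  convert key using 1
  match_scalars <;> field_simp
  ring

/-- Two disjoint two-piece convex paths from the ray through `e` to the ray through `f` keep
their order. -/
theorem radial_order_of_disjoint {V : Type*} [AddCommGroup V] [Module ℝ V]
    {p₁ q₁ p₂ q₂ : Set V} (hp₁ : Convex ℝ p₁) (hq₁ : Convex ℝ q₁) (hp₂ : Convex ℝ p₂)
    (hq₂ : Convex ℝ q₂) (hpp : Disjoint p₁ p₂) (hqq : Disjoint q₁ q₂) (hpq : Disjoint p₁ q₂)
    (hqp : Disjoint q₁ p₂) {e f : V} {s₁ s₂ t₁ t₂ x₁ y₁ x₂ y₂ : ℝ}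
    (hs₁ : 0 < s₁) (ht₂ : 0 < t₂) (hx₁ : 0 < x₁) (hy₁ : 0 < y₁) (hx₂ : 0 < x₂) (hy₂ : 0 < y₂)
    (hsp₁ : s₁ • e ∈ p₁) (hsp₂ : s₂ • e ∈ p₂) (htq₁ : t₁ • f ∈ q₁) (htq₂ : t₂ • f ∈ q₂)
    (hap₁ : x₁ • e + y₁ • f ∈ p₁) (haq₁ : x₁ • e + y₁ • f ∈ q₁)
    (hap₂ : x₂ • e + y₂ • f ∈ p₂) (haq₂ : x₂ • e + y₂ • f ∈ q₂) (hs : s₁ < s₂) : t₁ < t₂ := by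
  by_contra! ht
  have hs₂ : 0 < s₂ := hs₁.trans hs
  have ht₁ : 0 < t₁ := ht₂.trans_le ht
  have hse : (s₂ / s₁) • s₁ • e ∈ p₂ := by rwa [smul_smul, div_mul_cancel₀ _ hs₁.ne']
  have htf : (t₂ / t₁) • t₁ • f ∈ q₂ := by rwa [smul_smul, div_mul_cancel₀ _ ht₁.ne']
  have hs' : 1 ≤ s₂ / s₁ := (one_le_div hs₁).2 hs.le
  have ht' : t₂ / t₁ ≤ 1 := (div_le_one ht₁).2 ht
  have ht0 : 0 ≤ t₂ / t₁ := by positivity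
  have hinv : ∀ {k : ℝ} {v : V} {K : Set V}, 0 < k → v ∈ K → k⁻¹ • k • v ∈ K := by
    intro k v K hk hv
    rwa [inv_smul_smul₀ hk.ne']
  have no_meet : ∀ {K L : Set V}, Disjoint K L → ¬ (K ∩ L).Nonempty :=
    fun h => Set.not_nonempty_iff_eq_empty.2 h.inter_eq
  rcases le_total 0 (x₁ * y₂ - y₁ * x₂) with hc | hc
  · obtain ⟨k, hk0, hk⟩ := exists_pos_smul_mem_of_cross_nonneg hp₂ hs₂ hy₁ hy₂ hsp₂ hap₂ hc
    obtain ⟨l, hl0, hl⟩ := exists_pos_smul_mem_of_cross_nonneg (x := y₂) (y := x₂) hq₁ ht₁ hx₂ hx₁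
      htq₁ (by rwa [add_comm]) (by linarith)
    rw [add_comm] at hl
    have hk1 : 1 < k := by
      by_contra! h
      exact no_meet hpp (inter_nonempty_of_radial_swap hp₁ hp₂ hsp₁ hap₁ hse hk hs' hk0.le h)
    have hl1 : 1 < l⁻¹ := by
      by_contra! h
      exact no_meet hqp (inter_nonempty_of_radial_swap hq₁ hp₂ haq₁ hl hk (hinv hl0 hap₂) hk1.le
        (by positivity) h)
    exact no_meet hqq (inter_nonempty_of_radial_swap hq₁ hq₂ hl htq₁ (hinv hl0 haq₂) htf hl1.le
      ht0 ht')
  · obtain ⟨k, hk0, hk⟩ := exists_pos_smul_mem_of_cross_nonneg (x := x₂) (y := y₂) hp₁ hs₁ hy₂ hy₁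
      hsp₁ hap₁ (by linarith)
    obtain ⟨l, hl0, hl⟩ := exists_pos_smul_mem_of_cross_nonneg (x := y₁) (y := x₁) hq₂ ht₂ hx₁ hx₂
      htq₂ (by rwa [add_comm]) (by linarith)
    rw [add_comm] at hl
    have hk1 : 1 < k⁻¹ := by
      by_contra! h
      exact no_meet hpp (inter_nonempty_of_radial_swap hp₁ hp₂ hsp₁ hk hse (hinv hk0 hap₂) hs'
        (by positivity) h)
    have hl1 : 1 < l := by
      by_contra! h
      exact no_meet hpq (inter_nonempty_of_radial_swap hp₁ hq₂ hk hap₁ (hinv hk0 haq₂) hl hk1.le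
        hl0.le h)
    exact no_meet hqq (inter_nonempty_of_radial_swap hq₁ hq₂ haq₁ htq₁ hl htf hl1.le ht0 ht')

/-- A closed chain of eight convex sets whose contact points wind twice around the origin
cannot have all nonadjacent members disjoint. -/
theorem false_of_double_winding {V : Type*} [AddCommGroup V] [Module ℝ V] {C : Fin 8 → Set V}
    {u v : Fin 8 → V} (hC : ∀ k, Convex ℝ (C k)) (hv : ∀ k, v k ∈ C k)
    (hv' : ∀ k, v k ∈ C (k + 1)) (hu : ∀ k, u (k + 2) = -u k)
    (huv : ∀ k, ∃ x y : ℝ, 0 < x ∧ 0 < y ∧ v k = x • u k + y • u (k + 1))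
    (hd : ∀ j k, j ≠ k → j ≠ k + 1 → k ≠ j + 1 → Disjoint (C j) (C k)) : False := by
  choose x y hx hy hxy using huv
  have hs : ∀ k, ∃ s : ℝ, 0 < s ∧ s • u k ∈ C k := by
    intro k
    have h1 := hv' (k - 1)
    have h2 := hv k
    have h3 := hu (k - 1)
    rw [hxy, sub_add_cancel] at h1
    rw [hxy] at h2
    rw [(by decide : ∀ k : Fin 8, k - 1 + 2 = k + 1) k] at h3
    rw [h3] at h2
    have ha := hx k; have hb := hy k; have hc := hx (k - 1); have he := hy (k - 1)
    refine ⟨(y k * y (k - 1) + x (k - 1) * x k) / (y k + x (k - 1)), by positivity, ?_⟩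
    convert hC k h1 h2 (a := y k / (y k + x (k - 1))) (b := x (k - 1) / (y k + x (k - 1)))
      (by positivity) (by positivity) (by field_simp) using 1
    match_scalars <;> field_simp
    ring
  choose s hs0 hs using hs
  have hu4 : ∀ k, u (k + 4) = u k := by
    intro k
    rw [(by decide : ∀ k : Fin 8, k + 4 = k + 2 + 2) k, hu, hu, neg_neg]
  have hidx : ∀ k : Fin 8, (k ≠ k + 4 ∧ k ≠ k + 4 + 1 ∧ k + 4 ≠ k + 1) ∧
      (k ≠ k + 1 + 4 ∧ k ≠ k + 1 + 4 + 1 ∧ k + 1 + 4 ≠ k + 1) ∧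
      k + 1 ≠ k + 4 ∧ k + 1 ≠ k + 4 + 1 ∧ k + 4 ≠ k + 1 + 1 := by decide
  have hd4 : ∀ k, Disjoint (C k) (C (k + 4)) := fun k =>
    let ⟨⟨h1, h2, h3⟩, _⟩ := hidx k; hd _ _ h1 h2 h3
  have hd5 : ∀ k, Disjoint (C k) (C (k + 1 + 4)) := fun k =>
    let ⟨_, ⟨h1, h2, h3⟩, _⟩ := hidx k; hd _ _ h1 h2 h3
  have hd3 : ∀ k, Disjoint (C (k + 1)) (C (k + 4)) := fun k =>
    let ⟨_, _, h1, h2, h3⟩ := hidx k; hd _ _ h1 h2 h3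
  have step : ∀ k, s k < s (k + 4) → s (k + 1) < s (k + 1 + 4) := by
    intro k h
    have e1 : k + 4 + 1 = k + 1 + 4 := add_right_comm k 4 1
    have h1 := hs (k + 4)
    have h2 := hs (k + 1 + 4)
    have h3 := hv (k + 4)
    have h4 := hv' (k + 4)
    rw [hu4] at h1 h2
    rw [hxy, e1, hu4, hu4] at h3 h4
    have h5 := hv k
    have h6 := hv' k
    rw [hxy] at h5 h6
    refine radial_order_of_disjoint (hC k) (hC (k + 1)) (hC (k + 4)) (hC (k + 1 + 4))
      (hd4 k) (hd4 (k + 1)) (hd5 k) (hd3 k)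
      (hs0 _) (hs0 _) (hx k) (hy k) (hx (k + 4)) (hy (k + 4)) (hs k) h1 (hs _) h2 h5 h6 h3 h4 h
  have cycle : ∀ k, ¬ s k < s (k + 4) := by
    intro k h
    have h1 := step _ (step _ (step _ (step _ h)))
    have e1 : k + 1 + 1 + 1 + 1 = k + 4 := by simp only [add_assoc]; rfl
    have e2 : k + 4 + 4 = k := (add_assoc k 4 4).trans (add_zero k)
    rw [e1, e2] at h1
    exact lt_asymm h h1
  have h0 := hs 4
  rw [show (4 : Fin 8) = 0 + 4 from rfl, hu4] at h0
  rcases lt_trichotomy (s 0) (s (0 + 4)) with h | h | h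
  · exact cycle _ h
  · rw [← h] at h0
    exact Set.disjoint_left.1 (hd4 0) (hs 0) h0
  · exact cycle 4 h

theorem exists_strict_separator_of_finite {E : Type*} [NormedAddCommGroup E] [NormedSpace ℝ E]
    {S T C D : Set E} (hS : S.Finite) (hT : T.Finite) (hSC : S ⊆ C) (hTD : T ⊆ D)
    (hC : Convex ℝ C) (hD : Convex ℝ D) (hCD : DC C D) :
    ∃ (f : E →L[ℝ] ℝ) (α : ℝ), (∀ x ∈ S, α < f x) ∧ ∀ x ∈ T, f x < α := by
  obtain ⟨f, u, v, hu, huv, hv⟩ := geometric_hahn_banach_compact_closed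
    (convex_convexHull ℝ T) (hT.isCompact_convexHull ℝ) (convex_convexHull ℝ S)
    (hS.isCompact_convexHull ℝ).isClosed
    ((Set.disjoint_iff_inter_eq_empty.2 hCD).symm.mono (convexHull_min hTD hD)
      (convexHull_min hSC hC))
  exact ⟨f, u, fun x hx => huv.trans (hv x (subset_convexHull ℝ S hx)),
    fun x hx => hu x (subset_convexHull ℝ T hx)⟩

theorem EC.exists_separator {E : Type*} [NormedAddCommGroup E] [NormedSpace ℝ E] {P Q : Set E}
    (h : EC P Q) (hP : Convex ℝ P) (hQ : Convex ℝ Q) (hP' : RegClosed P) (hQ' : RegClosed Q) :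
    ∃ (f : E →L[ℝ] ℝ) (γ : ℝ), f ≠ 0 ∧ (∀ x ∈ P, f x ≤ γ) ∧ ∀ x ∈ Q, γ ≤ f x := by
  have hd : Disjoint (interior P) Q := by
    rw [← show closure (interior Q) = Q from hQ']
    exact (Set.disjoint_iff_inter_eq_empty.2 h.2).closure_right isOpen_interior
  obtain ⟨f, γ, hf, hf'⟩ := geometric_hahn_banach_open hP.interior isOpen_interior hQ hd
  obtain ⟨z, hzP, hzQ⟩ := h.1
  have hne : (interior P).Nonempty := by
    rw [← closure_nonempty_iff, show closure (interior P) = P from hP']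
    exact ⟨z, hzP⟩
  refine ⟨f, γ, ?_, fun x hx => ?_, hf'⟩
  · rintro rfl
    obtain ⟨y, hy⟩ := hne
    have h1 := hf y hy
    have h2 := hf' z hzQ
    simp only [zero_apply] at h1 h2
    exact h1.not_ge h2
  · rw [← show closure (interior P) = P from hP'] at hx
    exact closure_minimal (fun y hy => (hf y hy).le) (isClosed_le f.continuous continuous_const) hx

/-- On a three-dimensional space, a nonzero functional that is constant on four points, together
with two functionals realizing all four sign patterns on these points, is injective. -/
theorem eq_of_functionals_eq {E : Type*} [NormedAddCommGroup E] [NormedSpace ℝ E]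
    (hE : Module.finrank ℝ E = 3) {f g h : E →L[ℝ] ℝ} {α β γ : ℝ} {w : Fin 4 → E} (hh : h ≠ 0)
    (hw : ∀ i, h (w i) = γ) (f0 : α < f (w 0)) (f1 : f (w 1) < α) (f2 : f (w 2) < α)
    (f3 : α < f (w 3)) (g0 : β < g (w 0)) (g1 : β < g (w 1)) (g2 : g (w 2) < β)
    (g3 : g (w 3) < β) {x y : E} (hf : f x = f y) (hg : g x = g y) (hhxy : h x = h y) :
    x = y := by
  have : FiniteDimensional ℝ E := Module.finite_of_finrank_pos (by omega)
  let T : E →ₗ[ℝ] ℝ × ℝ × ℝ := (h : E →ₗ[ℝ] ℝ).prod ((f : E →ₗ[ℝ] ℝ).prod (g : E →ₗ[ℝ] ℝ))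
  suffices hT : Function.Injective T from
    hT (Prod.ext hhxy (Prod.ext hf hg))
  rw [LinearMap.injective_iff_surjective_of_finrank_eq_finrank (by simp [hE]),
    ← LinearMap.range_eq_top]
  by_contra hne
  obtain ⟨φ, hφ0, hφ⟩ := Submodule.exists_le_ker_of_lt_top _ (lt_top_iff_ne_top.2 hne)
  obtain ⟨l, hl⟩ : ∃ l, l = φ (1, 0, 0) := ⟨_, rfl⟩
  obtain ⟨m, hm⟩ : ∃ m, m = φ (0, 1, 0) := ⟨_, rfl⟩
  obtain ⟨n, hn⟩ : ∃ n, n = φ (0, 0, 1) := ⟨_, rfl⟩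
  have hφ' : ∀ a b c : ℝ, φ (a, b, c) = a * l + b * m + c * n := by
    intro a b c
    rw [hl, hm, hn, ← smul_eq_mul, ← smul_eq_mul, ← smul_eq_mul, ← map_smul, ← map_smul,
      ← map_smul, ← map_add, ← map_add]
    simp
  have key : ∀ z, h z * l + f z * m + g z * n = 0 := by
    intro z
    rw [← hφ']
    exact hφ ⟨z, rfl⟩
  have k0 := key (w 0)
  have k1 := key (w 1)
  have k2 := key (w 2)
  have k3 := key (w 3)
  rw [hw] at k0 k1 k2 k3
  have k02 : (f (w 0) - f (w 2)) * m + (g (w 0) - g (w 2)) * n = 0 := by linarith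
  have k31 : (f (w 3) - f (w 1)) * m = (g (w 1) - g (w 3)) * n := by linarith
  have a1 : 0 < f (w 0) - f (w 2) := by linarith
  have a2 : 0 < g (w 0) - g (w 2) := by linarith
  have a3 : 0 < f (w 3) - f (w 1) := by linarith
  have a4 : 0 < g (w 1) - g (w 3) := by linarith
  have hm0 : m = 0 := by
    have h1 : ((f (w 0) - f (w 2)) * (g (w 1) - g (w 3)) +
      (g (w 0) - g (w 2)) * (f (w 3) - f (w 1))) * m = 0 := by
      linear_combination (g (w 1) - g (w 3)) * k02 + (g (w 0) - g (w 2)) * k31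
    exact (mul_eq_zero.1 h1).resolve_left (by positivity)
  have hn0 : n = 0 := by
    rw [hm0] at k31
    exact (mul_eq_zero.1 (show (g (w 1) - g (w 3)) * n = 0 by linarith)).resolve_left a4.ne'
  have hl0 : l = 0 := by
    by_contra hl0
    refine hh (ContinuousLinearMap.ext fun z => ?_)
    have := key z
    rw [hm0, hn0] at this
    simpa [hl0] using this
  exact hφ0 (LinearMap.ext fun ⟨a, b, c⟩ => by rw [hφ', hl0, hm0, hn0]; simp)

/-- In a three-dimensional space, a closed chain of eight convex sets with nonadjacent members
disjoint cannot be grouped as prescribed. -/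
theorem false_of_convex_chain {E : Type*} [NormedAddCommGroup E] [NormedSpace ℝ E]
    (hE : Module.finrank ℝ E = 3) {C : Fin 8 → Set E} (hC : ∀ k, Convex ℝ (C k))
    (hne : ∀ k, (C k ∩ C (k + 1)).Nonempty)
    (hd : ∀ j k, j ≠ k → j ≠ k + 1 → k ≠ j + 1 → DC (C j) (C k))
    {P Q P₁ P₂ Q₁ Q₂ : Set E} (hP : Convex ℝ P) (hQ : Convex ℝ Q) (hP' : RegClosed P)
    (hQ' : RegClosed Q) (hP₁ : Convex ℝ P₁) (hP₂ : Convex ℝ P₂) (hQ₁ : Convex ℝ Q₁)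
    (hQ₂ : Convex ℝ Q₂) (hPQ : EC P Q) (hP₁P₂ : DC P₁ P₂) (hQ₁Q₂ : DC Q₁ Q₂)
    (hP₁P : P₁ ⊆ P) (hP₂P : P₂ ⊆ P) (hQ₁Q : Q₁ ⊆ Q) (hQ₂Q : Q₂ ⊆ Q)
    (h0 : C 0 ⊆ P₁) (h1 : C 1 ⊆ Q₁) (h2 : C 2 ⊆ P₂) (h3 : C 3 ⊆ Q₂)
    (h4 : C 4 ⊆ P₁) (h5 : C 5 ⊆ Q₁) (h6 : C 6 ⊆ P₂) (h7 : C 7 ⊆ Q₂) : False := by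
  choose w hw hw' using hne
  obtain ⟨h, γ, hh, hhP, hhQ⟩ := hPQ.exists_separator hP hQ hP' hQ'
  obtain ⟨f, α, hf, hf'⟩ := exists_strict_separator_of_finite (S := {w 0, w 3, w 4, w 7})
    (T := {w 1, w 2, w 5, w 6}) (by simp) (by simp)
    (by
      rintro x (rfl | rfl | rfl | rfl)
      exacts [h0 (hw 0), h4 (hw' 3), h4 (hw 4), h0 (hw' 7)])
    (by
      rintro x (rfl | rfl | rfl | rfl)
      exacts [h2 (hw' 1), h2 (hw 2), h6 (hw' 5), h6 (hw 6)]) hP₁ hP₂ hP₁P₂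
  obtain ⟨g, β, hg, hg'⟩ := exists_strict_separator_of_finite (S := {w 0, w 1, w 4, w 5})
    (T := {w 2, w 3, w 6, w 7}) (by simp) (by simp)
    (by
      rintro x (rfl | rfl | rfl | rfl)
      exacts [h1 (hw' 0), h1 (hw 1), h5 (hw' 4), h5 (hw 5)])
    (by
      rintro x (rfl | rfl | rfl | rfl)
      exacts [h3 (hw' 2), h3 (hw 3), h7 (hw' 6), h7 (hw 7)]) hQ₁ hQ₂ hQ₁Q₂
  simp only [Set.mem_insert_iff, Set.mem_singleton_iff, forall_eq_or_imp, forall_eq]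
    at hf hf' hg hg'
  obtain ⟨f0, f3, f4, f7⟩ := hf
  obtain ⟨f1, f2, f5, f6⟩ := hf'
  obtain ⟨g0, g1, g4, g5⟩ := hg
  obtain ⟨g2, g3, g6, g7⟩ := hg'
  have hmem : ∀ k, w k ∈ P ∧ w k ∈ Q := by
    intro k
    have a := hw k
    have b := hw' k
    fin_cases k
    exacts [⟨hP₁P (h0 a), hQ₁Q (h1 b)⟩, ⟨hP₂P (h2 b), hQ₁Q (h1 a)⟩, ⟨hP₂P (h2 a), hQ₂Q (h3 b)⟩,
      ⟨hP₁P (h4 b), hQ₂Q (h3 a)⟩, ⟨hP₁P (h4 a), hQ₁Q (h5 b)⟩, ⟨hP₂P (h6 b), hQ₁Q (h5 a)⟩,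
      ⟨hP₂P (h6 a), hQ₂Q (h7 b)⟩, ⟨hP₁P (h0 b), hQ₂Q (h7 a)⟩]
  have hγ : ∀ k, h (w k) = γ := fun k => le_antisymm (hhP _ (hmem k).1) (hhQ _ (hmem k).2)
  let τ : E → ℝ × ℝ := fun x => (f x - α, g x - β)
  refine false_of_double_winding (C := fun k => τ '' (C k ∩ {x | h x = γ}))
    (u := ![(1, 0), (0, 1), (-1, 0), (0, -1), (1, 0), (0, 1), (-1, 0), (0, -1)])
    (v := fun k => τ (w k)) ?_ ?_ ?_ ?_ ?_ ?_
  · rintro k _ ⟨x, ⟨hx, hxγ⟩, rfl⟩ _ ⟨y, ⟨hy, hyγ⟩, rfl⟩ a b ha hb hab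
    refine ⟨a • x + b • y, ⟨hC k hx hy ha hb hab, ?_⟩, ?_⟩
    · simp only [Set.mem_ofPred_eq] at hxγ hyγ
      simp only [Set.mem_ofPred_eq, map_add, map_smul, hxγ, hyγ, ← add_smul, hab, one_smul]
    · simp only [τ, map_add, map_smul, smul_eq_mul, Prod.smul_mk, Prod.mk_add_mk]
      exact Prod.ext (by linear_combination α * hab) (by linear_combination β * hab)
  · exact fun k => ⟨_, ⟨hw k, hγ k⟩, rfl⟩
  · exact fun k => ⟨_, ⟨hw' k, hγ k⟩, rfl⟩
  · intro k
    fin_cases k <;> simp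
  · intro k
    fin_cases k
    · exact ⟨f (w 0) - α, g (w 0) - β, by linarith, by linarith, by simp [τ]⟩
    · exact ⟨g (w 1) - β, α - f (w 1), by linarith, by linarith, by simp [τ]⟩
    · exact ⟨α - f (w 2), β - g (w 2), by linarith, by linarith, by simp [τ]⟩
    · exact ⟨β - g (w 3), f (w 3) - α, by linarith, by linarith, by simp [τ]⟩
    · exact ⟨f (w 4) - α, g (w 4) - β, by linarith, by linarith, by simp [τ]⟩
    · exact ⟨g (w 5) - β, α - f (w 5), by linarith, by linarith, by simp [τ]⟩
    · exact ⟨α - f (w 6), β - g (w 6), by linarith, by linarith, by simp [τ]⟩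
    · exact ⟨β - g (w 7), f (w 7) - α, by linarith, by linarith, by simp [τ]⟩
  · intro j k e1 e2 e3
    rw [Set.disjoint_left]
    rintro _ ⟨x, ⟨hx, hxγ⟩, rfl⟩ ⟨y, ⟨hy, hyγ⟩, hyx⟩
    obtain ⟨hfx, hgx⟩ := Prod.mk.inj hyx
    have hxy : x = y := eq_of_functionals_eq hE (w := ![w 0, w 1, w 2, w 3]) hh
      (by intro i; fin_cases i <;> exact hγ _) f0 f1 f2 f3 g0 g1 g2 g3
      (by linarith) (by linarith) (hxγ.trans hyγ.symm)
    exact (Set.disjoint_left.1 (Set.disjoint_iff_inter_eq_empty.2 (hd j k e1 e2 e3))) hx (hxy ▸ hy)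

/-- The union of the unit intervals with right (`s = 0`) or left (`s = 1`) endpoint `3 * k`, for
`k ∈ S`. -/
def contactCell (s : ℕ) (S : Finset (Fin 8)) : Set ℝ :=
  ⋃ k ∈ S, Set.Icc (3 * ((k : ℕ) : ℝ) - 1 + s) (3 * ((k : ℕ) : ℝ) + s)

theorem mem_contactCell {s : ℕ} {S : Finset (Fin 8)} {x : ℝ} : x ∈ contactCell s S ↔
    ∃ k ∈ S, 3 * ((k : ℕ) : ℝ) - 1 + s ≤ x ∧ x ≤ 3 * ((k : ℕ) : ℝ) + s := by
  simp only [contactCell, Set.mem_iUnion, Set.mem_Icc, exists_prop]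

theorem three_mul_mem_contactCell {s : ℕ} (hs : s ≤ 1) {S : Finset (Fin 8)} {k : Fin 8}
    (hk : k ∈ S) : 3 * ((k : ℕ) : ℝ) ∈ contactCell s S := by
  have hs' : (s : ℝ) ≤ 1 := by exact_mod_cast hs
  exact mem_contactCell.2 ⟨k, hk, by linarith, by simp⟩

theorem regClosed_contactCell (s : ℕ) (S : Finset (Fin 8)) : RegClosed (contactCell s S) := by
  have h : contactCell s S =
      closure (⋃ k ∈ S, Set.Ioo (3 * ((k : ℕ) : ℝ) - 1 + s) (3 * ((k : ℕ) : ℝ) + s)) := by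
    rw [S.closure_biUnion]
    refine Set.iUnion₂_congr fun k _ => (closure_Ioo ?_).symm
    linarith
  have ho : IsOpen (⋃ k ∈ S, Set.Ioo (3 * ((k : ℕ) : ℝ) - 1 + s) (3 * ((k : ℕ) : ℝ) + s)) :=
    isOpen_biUnion fun _ _ => isOpen_Ioo
  rw [h]
  exact (closure_minimal interior_subset isClosed_closure).antisymm
    (closure_mono (interior_maximal subset_closure ho))

theorem eq_of_mem_contactCells {s t : ℕ} (hs : s ≤ 1) (ht : t ≤ 1) {S T : Finset (Fin 8)} {x : ℝ}
    (hx : x ∈ contactCell s S) (hx' : x ∈ contactCell t T) :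
    ∃ k, k ∈ S ∧ k ∈ T ∧ (s ≠ t → x = 3 * ((k : ℕ) : ℝ)) := by
  obtain ⟨k, hk, h1, h2⟩ := mem_contactCell.1 hx
  obtain ⟨l, hl, h3, h4⟩ := mem_contactCell.1 hx'
  have hs' : (s : ℝ) ≤ 1 := by exact_mod_cast hs
  have ht' : (t : ℝ) ≤ 1 := by exact_mod_cast ht
  have hs0 : (0 : ℝ) ≤ s := by positivity
  have ht0 : (0 : ℝ) ≤ t := by positivity
  have a1 : 3 * (k : ℕ) ≤ 3 * (l : ℕ) + 2 := by
    have : 3 * ((k : ℕ) : ℝ) ≤ 3 * ((l : ℕ) : ℝ) + 2 := by linarith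
    exact_mod_cast this
  have a2 : 3 * (l : ℕ) ≤ 3 * (k : ℕ) + 2 := by
    have : 3 * ((l : ℕ) : ℝ) ≤ 3 * ((k : ℕ) : ℝ) + 2 := by linarith
    exact_mod_cast this
  obtain rfl : k = l := Fin.ext (by omega)
  refine ⟨k, hk, hl, fun hst => ?_⟩
  have : s = 0 ∧ t = 1 ∨ s = 1 ∧ t = 0 := by omega
  rcases this with ⟨rfl, rfl⟩ | ⟨rfl, rfl⟩ <;> norm_num at h1 h2 h3 h4 <;> linarith

theorem dc_contactCell {s t : ℕ} (hs : s ≤ 1) (ht : t ≤ 1) {S T : Finset (Fin 8)}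
    (h : Disjoint S T) : DC (contactCell s S) (contactCell t T) := by
  refine Set.eq_empty_of_forall_notMem fun x hx => ?_
  obtain ⟨k, hk, hk', -⟩ := eq_of_mem_contactCells hs ht hx.1 hx.2
  exact Finset.disjoint_left.1 h hk hk'

theorem ec_contactCell {s t : ℕ} (hs : s ≤ 1) (ht : t ≤ 1) (hst : s ≠ t) {S T : Finset (Fin 8)}
    (h : ¬ Disjoint S T) : EC (contactCell s S) (contactCell t T) := by
  obtain ⟨k, hk, hk'⟩ := Finset.not_disjoint_iff.1 h
  refine ⟨⟨_, three_mul_mem_contactCell hs hk, three_mul_mem_contactCell ht hk'⟩, ?_⟩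
  rw [← interior_inter, interior_eq_empty_iff_dense_compl]
  refine Set.Countable.dense_compl ℝ ((Set.countable_range fun k : Fin 8 =>
    3 * ((k : ℕ) : ℝ)).mono fun x hx => ?_)
  obtain ⟨k, -, -, h⟩ := eq_of_mem_contactCells hs ht hx.1 hx.2
  exact ⟨k, (h hst).symm⟩

theorem tpp_contactCell {s : ℕ} (hs : s ≤ 1) {S T : Finset (Fin 8)} (hS : S.Nonempty)
    (h : S ⊂ T) : TPP (contactCell s S) (contactCell s T) := by
  refine ⟨⟨Set.biUnion_subset_biUnion_left h.1, fun hTS => ?_⟩, fun hST => ?_⟩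
  · refine h.2 fun k hk => ?_
    have hmem : 3 * ((k : ℕ) : ℝ) ∈ contactCell (1 - s) {k} :=
      three_mul_mem_contactCell (by omega) (Finset.mem_singleton_self k)
    obtain ⟨l, hl, hl', -⟩ := eq_of_mem_contactCells hs (by omega)
      (hTS (three_mul_mem_contactCell hs hk)) hmem
    rwa [← Finset.mem_singleton.1 hl']
  · obtain ⟨k, hk⟩ := hS
    have hx := hST (three_mul_mem_contactCell hs hk)
    have hx' := three_mul_mem_contactCell (s := 1 - s) (by omega) (h.1 hk)
    rw [← show closure (interior (contactCell (1 - s) T)) = contactCell (1 - s) T from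
      regClosed_contactCell _ _] at hx'
    have hec := (ec_contactCell hs (show 1 - s ≤ 1 by omega) (by omega)
      (Finset.not_disjoint_iff.2 ⟨k, h.1 hk, h.1 hk⟩)).2
    exact (mem_closure_iff.1 hx' _ isOpen_interior hx).ne_empty hec

theorem DC.preimage {X Y : Type*} (e : X → Y) {a b : Set Y} (h : DC a b) : DC (e ⁻¹' a) (e ⁻¹' b) := by
  rw [DC, ← Set.preimage_inter, show a ∩ b = ∅ from h, Set.preimage_empty]

section Homeomorph

variable {X Y : Type*} [TopologicalSpace X] [TopologicalSpace Y] (e : X ≃ₜ Y) {a b : Set Y}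

theorem RegClosed.preimage_homeomorph (h : RegClosed a) : RegClosed (e ⁻¹' a) := by
  rw [RegClosed, ← e.preimage_interior, ← e.preimage_closure, show closure (interior a) = a from h]

theorem EC.preimage_homeomorph (h : EC a b) : EC (e ⁻¹' a) (e ⁻¹' b) := by
  refine ⟨h.1.preimage e.surjective, ?_⟩
  rw [← e.preimage_interior, ← e.preimage_interior, ← Set.preimage_inter, h.2, Set.preimage_empty]

theorem TPP.preimage_homeomorph (h : TPP a b) : TPP (e ⁻¹' a) (e ⁻¹' b) := by
  rw [TPP, ← e.preimage_interior, ssubset_iff_subset_not_subset,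
    e.surjective.preimage_subset_preimage_iff, e.surjective.preimage_subset_preimage_iff,
    e.surjective.preimage_subset_preimage_iff]
  exact h

end Homeomorph

/-- The contact points of the members of the network: a cyclic chain of eight leaves, four groups
of two opposite leaves each, and two sets containing two groups each. -/
def contactIndices : Fin 14 → Finset (Fin 8) :=
  ![{7, 0}, {0, 1}, {1, 2}, {2, 3}, {3, 4}, {4, 5}, {5, 6}, {6, 7},
    {0, 3, 4, 7}, {0, 1, 4, 5}, {1, 2, 5, 6}, {2, 3, 6, 7}, Finset.univ, Finset.univ]

theorem contactIndices_nonempty : ∀ i, (contactIndices i).Nonempty := by decide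

theorem contactIndices_laminar : ∀ i j : Fin 14, i ≠ j → (i : ℕ) % 2 = (j : ℕ) % 2 →
    Disjoint (contactIndices i) (contactIndices j) ∨ contactIndices i ⊂ contactIndices j ∨
      contactIndices j ⊂ contactIndices i := by decide

/-- There is a consistent atomic RCC8 network over {EC, DC, TPP, TPP⁻¹} with no
convex solution in ℝ³. -/
theorem statement14 :
    ∃ (m d : ℕ) (A : Fin m → Set (EuclideanSpace ℝ (Fin d))),
      (∀ i, (A i).Nonempty ∧ RegClosed (A i)) ∧
      (∀ i j : Fin m, i ≠ j →
        EC (A i) (A j) ∨ DC (A i) (A j) ∨ TPP (A i) (A j) ∨ TPP (A j) (A i)) ∧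
      ¬ (∃ B : Fin m → Set (EuclideanSpace ℝ (Fin 3)),
        (∀ i, (B i).Nonempty ∧ Convex ℝ (B i) ∧ RegClosed (B i)) ∧
        (∀ i j : Fin m, i ≠ j →
          (EC (B i) (B j) ↔ EC (A i) (A j)) ∧
          (DC (B i) (B j) ↔ DC (A i) (A j)) ∧
          (TPP (B i) (B j) ↔ TPP (A i) (A j)))) := by
  let e : EuclideanSpace ℝ (Fin 1) ≃ₜ ℝ :=
    (EuclideanSpace.equiv (Fin 1) ℝ).toHomeomorph.trans (Homeomorph.funUnique (Fin 1) ℝ)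
  let A : Fin 14 → Set (EuclideanSpace ℝ (Fin 1)) := fun i =>
    e ⁻¹' contactCell ((i : ℕ) % 2) (contactIndices i)
  have hmod : ∀ i : Fin 14, (i : ℕ) % 2 ≤ 1 := fun i => by omega
  have hDC : ∀ i j, Disjoint (contactIndices i) (contactIndices j) → DC (A i) (A j) :=
    fun i j h => (dc_contactCell (hmod i) (hmod j) h).preimage e
  have hEC : ∀ i j : Fin 14, (i : ℕ) % 2 ≠ (j : ℕ) % 2 →
      ¬ Disjoint (contactIndices i) (contactIndices j) → EC (A i) (A j) :=
    fun i j h h' => (ec_contactCell (hmod i) (hmod j) h h').preimage_homeomorph e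
  have hTPP : ∀ i j : Fin 14, (i : ℕ) % 2 = (j : ℕ) % 2 →
      contactIndices i ⊂ contactIndices j → TPP (A i) (A j) := by
    intro i j h h'
    have := (tpp_contactCell (hmod i) (contactIndices_nonempty i) h').preimage_homeomorph e
    simpa only [A, ← h] using this
  refine ⟨14, 1, A, fun i => ⟨?_, (regClosed_contactCell _ _).preimage_homeomorph e⟩, ?_, ?_⟩
  · obtain ⟨k, hk⟩ := contactIndices_nonempty i
    exact Set.Nonempty.preimage ⟨_, three_mul_mem_contactCell (hmod i) hk⟩ e.surjective
  · intro i j hij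
    by_cases hd : Disjoint (contactIndices i) (contactIndices j)
    · exact Or.inr (Or.inl (hDC i j hd))
    by_cases hs : (i : ℕ) % 2 = (j : ℕ) % 2
    · rcases contactIndices_laminar i j hij hs with h | h | h
      · exact absurd h hd
      · exact Or.inr (Or.inr (Or.inl (hTPP i j hs h)))
      · exact Or.inr (Or.inr (Or.inr (hTPP j i hs.symm h)))
    · exact Or.inl (hEC i j hs hd)
  · rintro ⟨B, hB, hBA⟩
    have bDC : ∀ i j, i ≠ j → Disjoint (contactIndices i) (contactIndices j) → DC (B i) (B j) :=
      fun i j hij h => (hBA i j hij).2.1.2 (hDC i j h)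
    have bEC : ∀ i j : Fin 14, (i : ℕ) % 2 ≠ (j : ℕ) % 2 →
        ¬ Disjoint (contactIndices i) (contactIndices j) → EC (B i) (B j) :=
      fun i j h h' => (hBA i j fun hij => h (by rw [hij])).1.2 (hEC i j h h')
    have bsub : ∀ i j : Fin 14, (i : ℕ) % 2 = (j : ℕ) % 2 →
        contactIndices i ⊂ contactIndices j → B i ⊆ B j :=
      fun i j h h' => ((hBA i j fun hij => h'.ne (by rw [hij])).2.2.2 (hTPP i j h h')).1.1
    have hc : ∀ i, Convex ℝ (B i) := fun i => (hB i).2.1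
    refine false_of_convex_chain (by simp) (C := fun k => B (Fin.castAdd 6 k))
      (P := B 12) (Q := B 13) (P₁ := B 8) (P₂ := B 10) (Q₁ := B 9) (Q₂ := B 11)
      (fun k => hc _) (fun k => (bEC _ _ ?_ ?_).1) (fun j k h1 h2 h3 => bDC _ _ ?_ ?_) (hc _) (hc _)
      (hB _).2.2 (hB _).2.2 (hc _) (hc _) (hc _) (hc _) (bEC _ _ (by decide) (by decide))
      (bDC _ _ (by decide) (by decide)) (bDC _ _ (by decide) (by decide))
      ?_ ?_ ?_ ?_ ?_ ?_ ?_ ?_ ?_ ?_ ?_ ?_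
    · exact (by decide : ∀ k : Fin 8, ((Fin.castAdd 6 k : Fin 14) : ℕ) % 2 ≠
        ((Fin.castAdd 6 (k + 1) : Fin 14) : ℕ) % 2) k
    · exact (by decide : ∀ k : Fin 8, ¬ Disjoint (contactIndices (Fin.castAdd 6 k))
        (contactIndices (Fin.castAdd 6 (k + 1)))) k
    · exact fun h => h1 (Fin.castAdd_injective 8 6 h)
    · exact (by decide : ∀ j k : Fin 8, j ≠ k → j ≠ k + 1 → k ≠ j + 1 →
        Disjoint (contactIndices (Fin.castAdd 6 j)) (contactIndices (Fin.castAdd 6 k)))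
        j k h1 h2 h3
    all_goals exact bsub _ _ (by decide) (by decide)
end

section
/- Let A : Fin m → Set (ℝ^d) be a family of nonempty regular closed subsets of a Euclidean space ℝ^d such that for all i ≠ j one of EC(A i, A j), DC(A i, A j), TPP(A i, A j), TPP(A j, A i), NTPP(A i, A j), NTPP(A j, A i) holds. Then there exists a family B : Fin m → Set ℝ⁴ of nonempty convex regular closed subsets of ℝ⁴ such that for all i ≠ j, EC(B i, B j) holds iff EC(A i, A j) holds, DC(B i, B j) holds iff DC(A i, A j) holds, TPP(B i, B j) holds iff TPP(A i, A j) holds, and NTPP(B i, B j) holds iff NTPP(A i, A j) holds. (Every consistent atomic RCC8 network over {EC, DC, TPP, TPP⁻¹, NTPP, NTPP⁻¹}, i.e. not using PO, has a convex solution in ℝ⁴.) -/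
open Filter Topology

/-- Euclidean four-space. -/
abbrev E4 := EuclideanSpace ℝ (Fin 4)

/-- Real-valued affine functions on `E4`. -/
abbrev Aff4 := E4 →ᵃ[ℝ] ℝ

/-- The linear parts of four affine functions form coordinates of `E4`. -/
def Indep4 (f₀ f₁ f₂ f₃ : Aff4) : Prop :=
  ∀ c₀ c₁ c₂ c₃ : ℝ, ∃ v : E4,
    f₀.linear v = c₀ ∧ f₁.linear v = c₁ ∧ f₂.linear v = c₂ ∧ f₃.linear v = c₃

/-- Continuous convergence of affine functions, as the parameter tends to `0` from the right. -/
def AffTendsto (F : ℝ → Aff4) (f : Aff4) : Prop :=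
  ∀ (y : ℝ → E4) (y₀ : E4), Tendsto y (𝓝[>] 0) (𝓝 y₀) →
    Tendsto (fun δ => F δ (y δ)) (𝓝[>] 0) (𝓝 (f y₀))

theorem AffTendsto.const (f : Aff4) : AffTendsto (fun _ => f) f := fun _ y₀ hy =>
  ((f.continuous_of_finiteDimensional).tendsto y₀).comp hy

theorem AffTendsto.add {F G : ℝ → Aff4} {f g : Aff4} (hF : AffTendsto F f) (hG : AffTendsto G g) :
    AffTendsto (fun δ => F δ + G δ) (f + g) := fun y y₀ hy => by
  simpa using (hF y y₀ hy).add (hG y y₀ hy)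

theorem AffTendsto.add_small {F G : ℝ → Aff4} {f g : Aff4} {c : ℝ → ℝ} (hF : AffTendsto F f)
    (hG : AffTendsto G g) (hc : Tendsto c (𝓝[>] 0) (𝓝 0)) :
    AffTendsto (fun δ => F δ + c δ • G δ) f := fun y y₀ hy => by
  simpa using (hF y y₀ hy).add (hc.mul (hG y y₀ hy))

theorem AffTendsto.linear {F : ℝ → Aff4} {f : Aff4} (hF : AffTendsto F f) (v : E4) :
    Tendsto (fun δ => (F δ).linear v) (𝓝[>] 0) (𝓝 (f.linear v)) := by
  have key : ∀ g : Aff4, g.linear v = g v - g 0 := fun g => by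
    have := g.linearMap_vsub v 0
    simpa using this
  simp only [key]
  exact (hF _ _ tendsto_const_nhds).sub (hF _ _ tendsto_const_nhds)

theorem Indep4.eventually {F₀ F₁ F₂ F₃ : ℝ → Aff4} {f₀ f₁ f₂ f₃ : Aff4}
    (h : Indep4 f₀ f₁ f₂ f₃) (h₀ : AffTendsto F₀ f₀) (h₁ : AffTendsto F₁ f₁)
    (h₂ : AffTendsto F₂ f₂) (h₃ : AffTendsto F₃ f₃) :
    ∀ᶠ δ in 𝓝[>] (0 : ℝ), Indep4 (F₀ δ) (F₁ δ) (F₂ δ) (F₃ δ) := by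
  let F : ℝ → Fin 4 → Aff4 := fun δ => ![F₀ δ, F₁ δ, F₂ δ, F₃ δ]
  let f : Fin 4 → Aff4 := ![f₀, f₁, f₂, f₃]
  have hv : ∀ j : Fin 4, ∃ v : E4, ∀ i, (f i).linear v = (1 : Matrix (Fin 4) (Fin 4) ℝ) i j := by
    intro j
    obtain ⟨v, e₀, e₁, e₂, e₃⟩ := h ((1 : Matrix (Fin 4) (Fin 4) ℝ) 0 j)
      ((1 : Matrix (Fin 4) (Fin 4) ℝ) 1 j) ((1 : Matrix (Fin 4) (Fin 4) ℝ) 2 j)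
      ((1 : Matrix (Fin 4) (Fin 4) ℝ) 3 j)
    refine ⟨v, fun i => ?_⟩
    fin_cases i
    exacts [e₀, e₁, e₂, e₃]
  choose v hv using hv
  have hF : ∀ i, AffTendsto (fun δ => F δ i) (f i) := by
    intro i
    fin_cases i
    exacts [h₀, h₁, h₂, h₃]
  let A : ℝ → Matrix (Fin 4) (Fin 4) ℝ := fun δ => Matrix.of fun i j => (F δ i).linear (v j)
  have hA : Tendsto A (𝓝[>] 0) (𝓝 1) := by
    refine tendsto_pi_nhds.2 fun i => tendsto_pi_nhds.2 fun j => ?_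
    rw [← hv j i]
    exact (hF i).linear (v j)
  have hdet : Tendsto (fun δ => (A δ).det) (𝓝[>] 0) (𝓝 1) := by
    have := (Continuous.matrix_det (continuous_id (X := Matrix (Fin 4) (Fin 4) ℝ))).tendsto 1
    simp only [id, Matrix.det_one] at this
    exact this.comp hA
  filter_upwards [hdet.eventually_ne one_ne_zero] with δ hδ
  intro c₀ c₁ c₂ c₃
  let c : Fin 4 → ℝ := ![c₀, c₁, c₂, c₃]
  let w : Fin 4 → ℝ := (A δ)⁻¹.mulVec c
  have hw : (A δ).mulVec w = c := by
    simp only [w, Matrix.mulVec_mulVec]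
    rw [Matrix.mul_nonsing_inv _ (isUnit_iff_ne_zero.2 hδ), Matrix.one_mulVec]
  have hs : ∀ i, (F δ i).linear (∑ j, w j • v j) = c i := by
    intro i
    rw [← hw, map_sum]
    simp only [Matrix.mulVec, dotProduct, A, Matrix.of_apply, map_smul, smul_eq_mul]
    exact Finset.sum_congr rfl fun j _ => mul_comm _ _
  exact ⟨_, hs 0, hs 1, hs 2, hs 3⟩

variable {Λ : Type}

/-- An affine function separating the points `q` of `D` from those of `E`, which is moreover strict
at all contact points `p` other than the one between two singletons. -/
def StrictSep (q : Λ → E4) (p : Λ → Λ → E4) (h : Λ → Aff4) (T : Λ → Λ → Aff4) (D E : Set Λ) :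
    Prop :=
  ∃ g : Aff4, (∀ a ∈ D, 0 < g (q a)) ∧ (∀ b ∈ E, g (q b) < 0) ∧
    (∀ a ∈ D, ∀ x ∉ E, a ≠ x → 0 < g (p a x)) ∧
    (∀ b ∈ E, ∀ x ∉ D, b ≠ x → g (p b x) < 0) ∧
    ∀ a ∈ D, ∀ b ∈ E,
      (D = {a} → E = {b} → g (p a b) = 0 ∧ Indep4 (T a b) (h a) (h b) g) ∧
      (D = {a} → E ≠ {b} → g (p a b) < 0) ∧ (D ≠ {a} → E = {b} → 0 < g (p a b))

/-- An affine function separating the points `q` of `D` from those of `E`, which vanishes at a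
contact point leaving `D` or `E` only if it is a multiple of the contact function there. -/
def WeakSep (q : Λ → E4) (p : Λ → Λ → E4) (T : Λ → Λ → Aff4) (D E : Set Λ) : Prop :=
  ∃ t : Aff4, (∀ a ∈ D, 0 < t (q a)) ∧ (∀ b ∈ E, t (q b) < 0) ∧
    (∀ a ∈ D, ∀ x, a ≠ x → 0 < t (p a x) ∨ x ∉ D ∧ ∃ c : ℝ, t = c • T a x) ∧
    (∀ b ∈ E, ∀ x, b ≠ x → t (p b x) < 0 ∨ x ∉ E ∧ ∃ c : ℝ, t = c • T b x)

/-- A configuration of points `q a` and pairwise contact points `p a b` in four-space, in which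
disjoint members of `𝓓` are separated. The affine functions `h a`, `L a`, `M a`, `N a` are
coordinates centred at `q a` and `T a b` is the hyperplane in which the contact at `p a b` takes
place; they allow a point to be split into two nearby ones. -/
structure ContactSystem (Λ : Type) (𝓓 : Set (Set Λ)) where
  q : Λ → E4
  p : Λ → Λ → E4
  h : Λ → Aff4
  L : Λ → Aff4
  M : Λ → Aff4
  N : Λ → Aff4
  T : Λ → Λ → Aff4
  p_symm : ∀ a b, p a b = p b a
  T_symm : ∀ a b, T a b = T b a
  indep : ∀ a, Indep4 (h a) (L a) (M a) (N a)
  h_q : ∀ a, h a (q a) = 0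
  L_q : ∀ a, L a (q a) = 0
  M_q : ∀ a, M a (q a) = 0
  N_q : ∀ a, N a (q a) = 0
  h_p : ∀ a b, a ≠ b → h a (p a b) = 0
  L_p : ∀ a b, a ≠ b → 0 < L a (p a b)
  M_p : ∀ a b, a ≠ b → 0 < M a (p a b)
  T_p : ∀ a b, a ≠ b → T a b (p a b) = 0
  strict : ∀ D ∈ 𝓓, ∀ E ∈ 𝓓, Disjoint D E → StrictSep q p h T D E
  weak : ∀ D ∈ 𝓓, ∀ E ∈ 𝓓, Disjoint D E → WeakSep q p T D E

theorem Indep4.neg_last {f₀ f₁ f₂ f₃ : Aff4} (h : Indep4 f₀ f₁ f₂ f₃) : Indep4 f₀ f₂ f₁ (-f₃) := by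
  intro c₀ c₁ c₂ c₃
  obtain ⟨v, h0, h1, h2, h3⟩ := h c₀ c₂ c₁ (-c₃)
  exact ⟨v, h0, h2, h1, by simp [h3]⟩

theorem StrictSep.symm {q : Λ → E4} {p : Λ → Λ → E4} {h : Λ → Aff4} {T : Λ → Λ → Aff4}
    {D E : Set Λ} (hp : ∀ a b, p a b = p b a) (hT : ∀ a b, T a b = T b a)
    (H : StrictSep q p h T D E) : StrictSep q p h T E D := by
  obtain ⟨g, h1, h2, h3, h4, h5⟩ := H
  refine ⟨-g, fun a ha => by simpa using h2 a ha, fun a ha => by simpa using h1 a ha,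
    fun a ha x hx hax => by simpa using h4 a ha x hx hax,
    fun a ha x hx hax => by simpa using h3 a ha x hx hax, fun a ha b hb => ?_⟩
  obtain ⟨k1, k2, k3⟩ := h5 b hb a ha
  rw [hp a b, hT a b]
  refine ⟨fun e1 e2 => ?_, fun e1 e2 => by simpa using k3 e2 e1,
    fun e1 e2 => by simpa using k2 e2 e1⟩
  obtain ⟨k, k'⟩ := k1 e2 e1
  exact ⟨by simp [k], k'.neg_last⟩

/-- The data needed to split the point `a` of a contact system along a map `π`: points of the fibre
over `a` are moved in the coordinates `A x`, `B x`, with signs `σ x`. -/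
structure Splitting (Λ Λ' : Type) (𝓓 : Set (Set Λ')) where
  C : ContactSystem Λ' 𝓓
  π : Λ → Λ'
  a : Λ'
  σ : Λ → ℝ
  surj : Function.Surjective π
  fiber : ∀ x y, x ≠ y → π x = π y → π x = a
  nontriv : ∀ x, ({x} : Set Λ) ≠ π ⁻¹' {a}
  σ_sq : ∀ x, σ x * σ x = 1
  σ_neg : ∀ x y, x ≠ y → π x = π y → σ y = -σ x
  A : Λ → Aff4
  B : Λ → Aff4
  A_swap : ∀ x y, x ≠ y → π x = π y → A y = B x
  A_q : ∀ x, A x (C.q a) = 0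
  B_q : ∀ x, B x (C.q a) = 0
  A_p : ∀ x b, a ≠ b → 0 < A x (C.p a b)
  B_p : ∀ x b, a ≠ b → 0 < B x (C.p a b)
  indepAB : ∀ x, Indep4 (C.h a) (A x) (B x) (C.N a)
  e : Λ → E4
  e' : Λ → E4
  eh : Λ → E4
  he : ∀ x, (C.h a).linear (e x) = 0 ∧ (A x).linear (e x) = 1 ∧ (B x).linear (e x) = 0 ∧
    (C.N a).linear (e x) = 0
  he' : ∀ x, (C.h a).linear (e' x) = 0 ∧ (A x).linear (e' x) = 0 ∧ (B x).linear (e' x) = 1 ∧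
    (C.N a).linear (e' x) = 0
  heh : ∀ x, (C.h a).linear (eh x) = 1 ∧ (A x).linear (eh x) = 0 ∧ (B x).linear (eh x) = 0 ∧
    (C.N a).linear (eh x) = 0
  g : Λ' → Aff4
  g_qa : ∀ b, a ≠ b → 0 < g b (C.q a)
  g_qb : ∀ b, a ≠ b → g b (C.q b) < 0
  g_pa : ∀ b, a ≠ b → ∀ c, c ≠ b → a ≠ c → 0 < g b (C.p a c)
  g_pb : ∀ b, a ≠ b → ∀ c, c ≠ a → b ≠ c → g b (C.p b c) < 0
  g_ab : ∀ b, a ≠ b → g b (C.p a b) = 0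
  g_indep : ∀ b, a ≠ b → Indep4 (C.T a b) (C.h a) (C.h b) (g b)
  u : Λ' → E4
  v : Λ' → E4
  hu : ∀ b, a ≠ b → (C.T a b).linear (u b) = 0 ∧ (C.h a).linear (u b) = 1 ∧
    (C.h b).linear (u b) = 0 ∧ (g b).linear (u b) = 0
  hv : ∀ b, a ≠ b → (C.T a b).linear (v b) = 0 ∧ (C.h a).linear (v b) = 0 ∧
    (C.h b).linear (v b) = 0 ∧ (g b).linear (v b) = 1

theorem Aff4.apply_add (f : Aff4) (x v : E4) : f (x + v) = f x + f.linear v := by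
  have := f.map_vadd x v
  simp only [vadd_eq_add] at this
  rw [add_comm x v, this, add_comm]

namespace Splitting

variable {Λ' : Type} {𝓓 : Set (Set Λ')} (S : Splitting Λ Λ' 𝓓)

open Classical in
/-- The points of the split system. -/
noncomputable def q (δ : ℝ) (x : Λ) : E4 :=
  if S.π x = S.a then S.C.q S.a + (δ • S.e x + (-3 * δ) • S.e' x + (δ ^ 2 * S.σ x) • S.eh x)
  else S.C.q (S.π x)

open Classical in
/-- The functions `h` of the split system. -/
noncomputable def h (δ : ℝ) (x : Λ) : Aff4 :=
  if S.π x = S.a then S.C.h S.a + (-(δ * S.σ x)) • S.A x else S.C.h (S.π x)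

open Classical in
/-- The functions `L` of the split system. -/
noncomputable def L (δ : ℝ) (x : Λ) : Aff4 :=
  if S.π x = S.a then S.A x + S.B x + (2 * δ) • AffineMap.const ℝ E4 (1 : ℝ) else S.C.L (S.π x)

open Classical in
/-- The functions `M` of the split system. -/
noncomputable def M (δ : ℝ) (x : Λ) : Aff4 :=
  if S.π x = S.a then S.B x + (3 * δ) • AffineMap.const ℝ E4 (1 : ℝ) else S.C.M (S.π x)

open Classical in
/-- The contact functions of the split system. -/
noncomputable def T (x y : Λ) : Aff4 :=
  if S.π x = S.π y then S.C.h S.a else S.C.T (S.π x) (S.π y)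

/-- The amount by which the contact point of `x` with `b` moves along `S.u b`. -/
noncomputable def s (δ : ℝ) (x : Λ) (b : Λ') : ℝ :=
  δ * S.σ x * (S.A x (S.C.p S.a b) + δ * (S.A x).linear (S.v b)) /
    (1 - δ * S.σ x * (S.A x).linear (S.u b))

/-- The contact point of a point `x` of the special fibre with `b`. -/
noncomputable def r (δ : ℝ) (x : Λ) (b : Λ') : E4 :=
  S.C.p S.a b + (S.s δ x b • S.u b + δ • S.v b)

open Classical in
/-- The contact points of the split system. -/
noncomputable def p (δ : ℝ) (x y : Λ) : E4 :=
  if S.π x = S.π y then S.C.q S.a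
  else if S.π x = S.a then S.r δ x (S.π y)
  else if S.π y = S.a then S.r δ y (S.π x)
  else S.C.p (S.π x) (S.π y)

theorem p_symm (δ : ℝ) (x y : Λ) : S.p δ x y = S.p δ y x := by
  unfold p
  split_ifs <;> simp_all [S.C.p_symm (S.π x)]

theorem T_symm (x y : Λ) : S.T x y = S.T y x := by
  unfold T
  split_ifs <;> simp_all [S.C.T_symm (S.π x)]

theorem tendsto_param : Tendsto (fun δ : ℝ => δ) (𝓝[>] 0) (𝓝 0) :=
  tendsto_nhdsWithin_of_tendsto_nhds tendsto_id

theorem tendsto_zero_of_continuous {f : ℝ → ℝ} (hf : Continuous f) (h0 : f 0 = 0) :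
    Tendsto f (𝓝[>] 0) (𝓝 0) := by
  have := hf.tendsto 0
  rw [h0] at this
  exact tendsto_nhdsWithin_of_tendsto_nhds this

theorem q_tendsto (x : Λ) : Tendsto (fun δ => S.q δ x) (𝓝[>] 0) (𝓝 (S.C.q (S.π x))) := by
  unfold q
  split_ifs with hx
  · rw [hx]
    have : Continuous fun δ : ℝ => S.C.q S.a +
        (δ • S.e x + (-3 * δ) • S.e' x + (δ ^ 2 * S.σ x) • S.eh x) := by fun_prop
    have := this.tendsto 0
    simp only [zero_smul, mul_zero, add_zero, ne_eq, OfNat.ofNat_ne_zero, not_false_eq_true,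
      zero_pow, zero_mul] at this
    exact tendsto_nhdsWithin_of_tendsto_nhds this
  · exact tendsto_const_nhds

theorem s_tendsto (x : Λ) (b : Λ') : Tendsto (fun δ => S.s δ x b) (𝓝[>] 0) (𝓝 0) := by
  have h1 : Tendsto (fun δ : ℝ => δ * S.σ x * (S.A x (S.C.p S.a b) + δ * (S.A x).linear (S.v b)))
      (𝓝[>] 0) (𝓝 0) := tendsto_zero_of_continuous (by fun_prop) (by simp)
  have h2 : Tendsto (fun δ : ℝ => 1 - δ * S.σ x * (S.A x).linear (S.u b)) (𝓝[>] 0) (𝓝 (1 - 0)) :=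
    tendsto_const_nhds.sub (tendsto_zero_of_continuous (by fun_prop) (by simp))
  have := h1.div h2 (by norm_num)
  rw [zero_div] at this
  exact this

theorem p_tendsto {x y : Λ} (hxy : S.π x ≠ S.π y) :
    Tendsto (fun δ => S.p δ x y) (𝓝[>] 0) (𝓝 (S.C.p (S.π x) (S.π y))) := by
  have hr : ∀ x b, Tendsto (fun δ => S.r δ x b) (𝓝[>] 0) (𝓝 (S.C.p S.a b)) := fun x b => by
    have := tendsto_const_nhds (x := S.C.p S.a b) |>.add
      (((S.s_tendsto x b).smul_const (S.u b)).add (tendsto_param.smul_const (S.v b)))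
    simpa [r] using this
  simp only [p, if_neg hxy]
  split_ifs with h1 h2
  · rw [h1]; exact hr _ _
  · rw [h2, S.C.p_symm]; exact hr _ _
  · exact tendsto_const_nhds

theorem p_fiber {x y : Λ} (hxy : S.π x = S.π y) (δ : ℝ) : S.p δ x y = S.C.q S.a := if_pos hxy

theorem q_special {x : Λ} (hx : S.π x = S.a) (δ : ℝ) :
    S.C.h S.a (S.q δ x) = δ ^ 2 * S.σ x ∧ S.A x (S.q δ x) = δ ∧ S.B x (S.q δ x) = -3 * δ ∧
      S.C.N S.a (S.q δ x) = 0 := by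
  obtain ⟨a0, a1, a2, a3⟩ := S.he x
  obtain ⟨b0, b1, b2, b3⟩ := S.he' x
  obtain ⟨c0, c1, c2, c3⟩ := S.heh x
  simp only [q, if_pos hx, Aff4.apply_add, map_add, map_smul, smul_eq_mul, a0, a1, a2, a3, b0, b1,
    b2, b3, c0, c1, c2, c3, S.C.h_q, S.C.N_q, S.A_q, S.B_q]
  refine ⟨?_, ?_, ?_, ?_⟩ <;> ring

theorem h_special {x : Λ} (hx : S.π x = S.a) (δ : ℝ) :
    S.h δ x = S.C.h S.a + (-(δ * S.σ x)) • S.A x := if_pos hx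

theorem h_tendsto (x : Λ) : AffTendsto (fun δ => S.h δ x) (S.C.h (S.π x)) := by
  unfold h
  split_ifs with hx
  · rw [hx]
    exact (AffTendsto.const _).add_small (AffTendsto.const _)
      (tendsto_zero_of_continuous (by fun_prop) (by simp))
  · exact AffTendsto.const _

theorem L_tendsto {x : Λ} (hx : S.π x = S.a) : AffTendsto (fun δ => S.L δ x) (S.A x + S.B x) := by
  simp only [L, if_pos hx]
  exact (AffTendsto.const _).add_small (AffTendsto.const _)
      (tendsto_zero_of_continuous (by fun_prop) (by simp))

theorem M_tendsto {x : Λ} (hx : S.π x = S.a) : AffTendsto (fun δ => S.M δ x) (S.B x) := by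
  simp only [M, if_pos hx]
  exact (AffTendsto.const _).add_small (AffTendsto.const _)
      (tendsto_zero_of_continuous (by fun_prop) (by simp))

theorem r_spec (x : Λ) {b : Λ'} (hb : S.a ≠ b) : ∀ᶠ δ in 𝓝[>] (0 : ℝ),
    S.C.T S.a b (S.r δ x b) = 0 ∧ S.C.h S.a (S.r δ x b) = δ * S.σ x * S.A x (S.r δ x b) ∧
      S.C.h b (S.r δ x b) = 0 ∧ S.g b (S.r δ x b) = δ := by
  have h2 : Tendsto (fun δ : ℝ => 1 - δ * S.σ x * (S.A x).linear (S.u b)) (𝓝[>] 0) (𝓝 (1 - 0)) :=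
    tendsto_const_nhds.sub (tendsto_zero_of_continuous (by fun_prop) (by simp))
  filter_upwards [h2.eventually_ne (by norm_num : (1 - 0 : ℝ) ≠ 0)] with δ hδ
  obtain ⟨a0, a1, a2, a3⟩ := S.hu b hb
  obtain ⟨b0, b1, b2, b3⟩ := S.hv b hb
  have hT := S.C.T_p S.a b hb
  have hh := S.C.h_p S.a b hb
  have hh' := S.C.h_p b S.a hb.symm
  rw [S.C.p_symm] at hh'
  have hs : S.s δ x b * (1 - δ * S.σ x * (S.A x).linear (S.u b)) =
      δ * S.σ x * (S.A x (S.C.p S.a b) + δ * (S.A x).linear (S.v b)) := div_mul_cancel₀ _ hδ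
  simp only [r, Aff4.apply_add, map_add, map_smul, smul_eq_mul, a0, a1, a2, a3, b0, b1,
    b2, b3, hT, hh, hh', S.g_ab b hb]
  refine ⟨by ring, by linear_combination hs, by ring, by ring⟩

theorem T_p (x y : Λ) :
    ∀ᶠ δ in 𝓝[>] (0 : ℝ), S.T x y (S.p δ x y) = 0 := by
  unfold T p
  split_ifs with h0 h1 h2
  · simp [S.C.h_q]
  · rw [h1] at h0 ⊢
    filter_upwards [S.r_spec x h0] with δ hδ using hδ.1
  · rw [h2] at h0 ⊢
    rw [S.C.T_symm]
    filter_upwards [S.r_spec y (Ne.symm h0)] with δ hδ using hδ.1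
  · exact .of_forall fun _ => S.C.T_p _ _ h0

theorem h_p {x y : Λ} (hxy : x ≠ y) :
    ∀ᶠ δ in 𝓝[>] (0 : ℝ), S.h δ x (S.p δ x y) = 0 := by
  by_cases h0 : S.π x = S.π y
  · simp [S.p_fiber h0, S.h_special (S.fiber _ _ hxy h0), S.C.h_q, S.A_q]
  simp only [h, p, if_neg h0]
  split_ifs with h1 h2
  · rw [h1] at h0
    filter_upwards [S.r_spec x h0] with δ hδ
    simp [hδ.2.1]
  · rw [h2] at h0
    filter_upwards [S.r_spec y (Ne.symm h0)] with δ hδ using hδ.2.2.1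
  · exact .of_forall fun _ => S.C.h_p _ _ h0

theorem g_p {x y : Λ} (hx : S.π x = S.a) (hy : S.a ≠ S.π y) :
    ∀ᶠ δ in 𝓝[>] (0 : ℝ), S.g (S.π y) (S.p δ x y) = δ := by
  have hxy : S.π x ≠ S.π y := hx ▸ hy
  simp only [p, if_neg hxy, if_pos hx]
  filter_upwards [S.r_spec x hy] with δ hδ using hδ.2.2.2

theorem q_h (x : Λ) (δ : ℝ) : S.h δ x (S.q δ x) = 0 := by
  by_cases hx : S.π x = S.a
  · simp [S.h_special hx, S.q_special hx]; ring
  · simp [h, q, hx, S.C.h_q]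

theorem q_L (x : Λ) (δ : ℝ) : S.L δ x (S.q δ x) = 0 := by
  by_cases hx : S.π x = S.a
  · simp [L, hx, S.q_special hx]; ring
  · simp [L, q, hx, S.C.L_q]

theorem q_M (x : Λ) (δ : ℝ) : S.M δ x (S.q δ x) = 0 := by
  by_cases hx : S.π x = S.a
  · simp [M, hx, S.q_special hx]
  · simp [M, q, hx, S.C.M_q]

theorem q_N (x : Λ) (δ : ℝ) : S.C.N (S.π x) (S.q δ x) = 0 := by
  by_cases hx : S.π x = S.a
  · simp [hx, S.q_special hx]
  · simp [q, hx, S.C.N_q]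

theorem indep (x : Λ) :
    ∀ᶠ δ in 𝓝[>] (0 : ℝ), Indep4 (S.h δ x) (S.L δ x) (S.M δ x) (S.C.N (S.π x)) := by
  by_cases hx : S.π x = S.a
  · refine Indep4.eventually ?_ (S.h_tendsto x) (S.L_tendsto hx) (S.M_tendsto hx) (.const _)
    rw [hx]
    intro c₀ c₁ c₂ c₃
    obtain ⟨v, h0, h1, h2, h3⟩ := S.indepAB x c₀ (c₁ - c₂) c₂ c₃
    exact ⟨v, h0, by simp [h1, h2], h2, h3⟩
  · simp only [h, L, M, if_neg hx]
    exact .of_forall fun _ => S.C.indep _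

theorem L_p {x y : Λ} (hxy : x ≠ y) :
    ∀ᶠ δ in 𝓝[>] (0 : ℝ), 0 < S.L δ x (S.p δ x y) := by
  by_cases h0 : S.π x = S.π y
  · filter_upwards [self_mem_nhdsWithin] with δ (hδ : 0 < δ)
    simp [S.p_fiber h0, L, S.fiber _ _ hxy h0, S.A_q, S.B_q, hδ]
  by_cases hx : S.π x = S.a
  · refine (S.L_tendsto hx _ _ (S.p_tendsto h0)).eventually_const_lt ?_
    rw [hx] at h0 ⊢
    exact add_pos (S.A_p _ _ h0) (S.B_p _ _ h0)
  · simp only [L, if_neg hx]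
    exact (AffTendsto.const _ _ _ (S.p_tendsto h0)).eventually_const_lt (S.C.L_p _ _ h0)

theorem M_p {x y : Λ} (hxy : x ≠ y) :
    ∀ᶠ δ in 𝓝[>] (0 : ℝ), 0 < S.M δ x (S.p δ x y) := by
  by_cases h0 : S.π x = S.π y
  · filter_upwards [self_mem_nhdsWithin] with δ (hδ : 0 < δ)
    simp [S.p_fiber h0, M, S.fiber _ _ hxy h0, S.B_q, hδ]
  by_cases hx : S.π x = S.a
  · refine (S.M_tendsto hx _ _ (S.p_tendsto h0)).eventually_const_lt ?_
    rw [hx] at h0 ⊢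
    exact S.B_p _ _ h0
  · simp only [M, if_neg hx]
    exact (AffTendsto.const _ _ _ (S.p_tendsto h0)).eventually_const_lt (S.C.M_p _ _ h0)

theorem fiber_special {x w : Λ} (hxw : x ≠ w) (h : S.π x = S.π w) : S.π w = S.a :=
  h ▸ S.fiber x w hxw h

theorem weak_half [Finite Λ] {t : Aff4} {D' : Set Λ'} {D : Set Λ} (hD : D ⊆ S.π ⁻¹' D')
    (h1 : ∀ a ∈ D', 0 < t (S.C.q a))
    (h2 : ∀ a ∈ D', ∀ x, a ≠ x → 0 < t (S.C.p a x) ∨ x ∉ D' ∧ ∃ c : ℝ, t = c • S.C.T a x) :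
    ∀ᶠ δ in 𝓝[>] (0 : ℝ), (∀ x ∈ D, 0 < t (S.q δ x)) ∧
      ∀ x ∈ D, ∀ y, x ≠ y → 0 < t (S.p δ x y) ∨ y ∉ D ∧ ∃ c : ℝ, t = c • S.T x y := by
  simp only [eventually_and, eventually_all]
  refine ⟨fun x hx => (AffTendsto.const t _ _ (S.q_tendsto x)).eventually_const_lt (h1 _ (hD hx)),
    fun x hx y hxy => ?_⟩
  by_cases h0 : S.π x = S.π y
  · refine .of_forall fun δ => .inl ?_
    rw [S.p_fiber h0]
    exact h1 _ (S.fiber _ _ hxy h0 ▸ hD hx)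
  rcases h2 _ (hD hx) _ h0 with h | ⟨hy, c, hc⟩
  · exact ((AffTendsto.const t _ _ (S.p_tendsto h0)).eventually_const_lt h).mono fun _ => .inl
  · exact .of_forall fun δ => .inr ⟨fun h => hy (hD h), c, by rw [T, if_neg h0, hc]⟩

theorem weak [Finite Λ] {D' E' : Set Λ'} {D E : Set Λ} (hD' : D' ∈ 𝓓) (hE' : E' ∈ 𝓓)
    (hDE : Disjoint D' E') (hD : D ⊆ S.π ⁻¹' D') (hE : E ⊆ S.π ⁻¹' E') :
    ∀ᶠ δ in 𝓝[>] (0 : ℝ), WeakSep (S.q δ) (S.p δ) S.T D E := by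
  obtain ⟨t, h1, h2, h3, h4⟩ := S.C.weak D' hD' E' hE' hDE
  have k1 := S.weak_half hD h1 h3
  have k2 := S.weak_half (t := -t) hE (by simpa using h2) fun b hb x hx => by
    refine (h4 b hb x hx).imp (fun h => by simpa using h) ?_
    rintro ⟨h, c, rfl⟩
    exact ⟨h, -c, by simp⟩
  filter_upwards [k1, k2] with δ k1 k2
  refine ⟨t, k1.1, by simpa using k2.1, k1.2, fun b hb x hx => ?_⟩
  refine (k2.2 b hb x hx).imp (fun h => by simpa using h) ?_
  rintro ⟨h, c, hc⟩
  exact ⟨h, -c, by rw [neg_smul, ← hc, neg_neg]⟩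

theorem special_half [Finite Λ] {x : Λ} (hx : S.π x = S.a) (c : ℝ) :
    ∀ᶠ δ in 𝓝[>] (0 : ℝ), 0 < (S.σ x • S.C.h S.a + (c * δ ^ 2) • S.C.N S.a) (S.q δ x) ∧
      ∀ w, S.π w ≠ S.a →
        0 < (S.σ x • S.C.h S.a + (c * δ ^ 2) • S.C.N S.a) (S.p δ x w) := by
  simp only [eventually_and, eventually_all]
  constructor
  · filter_upwards [self_mem_nhdsWithin] with δ (hδ : 0 < δ)
    have := S.σ_sq x
    have e : S.σ x * (δ ^ 2 * S.σ x) = δ ^ 2 := by linear_combination δ ^ 2 * this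
    simp [S.q_special hx, e, hδ]
  · intro w hw
    have h0 : S.π x ≠ S.π w := fun h => hw (h ▸ hx)
    have hp := S.p_tendsto h0
    rw [hx] at hp
    have hlim := (AffTendsto.const (S.A x)).add_small (AffTendsto.const (S.C.N S.a))
      (tendsto_zero_of_continuous (f := fun δ => c * δ) (by fun_prop) (by simp)) _ _ hp
    filter_upwards [self_mem_nhdsWithin, S.h_p (ne_of_apply_ne S.π h0),
      hlim.eventually_const_lt (S.A_p x _ (Ne.symm hw))] with δ (hδ : 0 < δ) hh hpos
    rw [S.h_special hx] at hh
    simp only [AffineMap.coe_add, AffineMap.coe_smul, Pi.add_apply, Pi.smul_apply,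
      smul_eq_mul] at hh hpos ⊢
    have := S.σ_sq x
    have e : S.σ x * S.C.h S.a (S.p δ x w) + c * δ ^ 2 * S.C.N S.a (S.p δ x w) =
        δ * (S.A x (S.p δ x w) + c * δ * S.C.N S.a (S.p δ x w)) := by
      linear_combination S.σ x * hh + δ * S.A x (S.p δ x w) * this
    rw [e]
    positivity

theorem eq_of_special {x y w : Λ} (hxy : x ≠ y) (hx : S.π x = S.a) (hy : S.π y = S.a)
    (hw : S.π w = S.a) (hxw : x ≠ w) : w = y := by
  by_contra hwy
  have h1 := S.σ_neg x y hxy (hx.trans hy.symm)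
  have h2 := S.σ_neg x w hxw (hx.trans hw.symm)
  have h3 := S.σ_neg w y hwy (hw.trans hy.symm)
  have := S.σ_sq x
  have : S.σ x = 0 := by linarith
  simp_all

theorem weak_special [Finite Λ] {x y : Λ} (hxy : x ≠ y) (hx : S.π x = S.a) (hy : S.π y = S.a) :
    ∀ᶠ δ in 𝓝[>] (0 : ℝ), WeakSep (S.q δ) (S.p δ) S.T {x} {y} := by
  filter_upwards [S.special_half hx 0, S.special_half hy 0] with δ h1 h2
  simp only [zero_mul, zero_smul, add_zero, S.σ_neg x y hxy (hx.trans hy.symm)] at h1 h2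
  refine ⟨S.σ x • S.C.h S.a, by simpa using h1.1, by simpa using h2.1, ?_, ?_⟩
  · rintro _ rfl w hw
    by_cases h0 : S.π w = S.a
    · exact .inr ⟨hw.symm, S.σ _, by rw [T, if_pos (hx.trans h0.symm)]⟩
    · exact .inl (h1.2 w h0)
  · rintro _ rfl w hw
    by_cases h0 : S.π w = S.a
    · exact .inr ⟨hw.symm, S.σ _, by rw [T, if_pos (hy.trans h0.symm)]⟩
    · exact .inl (by simpa using h2.2 w h0)

theorem strict_special [Finite Λ] {x y : Λ} (hxy : x ≠ y) (hx : S.π x = S.a)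
    (hy : S.π y = S.a) :
    ∀ᶠ δ in 𝓝[>] (0 : ℝ), StrictSep (S.q δ) (S.p δ) (S.h δ) S.T {x} {y} := by
  have hσ := S.σ_neg x y hxy (hx.trans hy.symm)
  filter_upwards [S.special_half hx 1, S.special_half hy (-1), self_mem_nhdsWithin]
    with δ h1 h2 (hδ : 0 < δ)
  have e : S.σ y • S.C.h S.a + (-1 * δ ^ 2) • S.C.N S.a =
      -(S.σ x • S.C.h S.a + (1 * δ ^ 2) • S.C.N S.a) := by rw [hσ]; module
  rw [e] at h2
  set g := S.σ x • S.C.h S.a + (1 * δ ^ 2) • S.C.N S.a with hg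
  refine ⟨g, by simpa using h1.1, by simpa using h2.1, ?_, ?_, ?_⟩
  · rintro _ rfl w hw hxw
    exact h1.2 w fun h => hw (S.eq_of_special hxy hx hy h hxw)
  · rintro _ rfl w hw hyw
    simpa using h2.2 w fun h => hw (S.eq_of_special hxy.symm hy hx h hyw)
  · simp only [Set.mem_singleton_iff, forall_eq]
    refine ⟨fun _ _ => ⟨?_, ?_⟩, fun _ h => absurd rfl h, fun h => absurd rfl h⟩
    · simp [S.p_fiber (hx.trans hy.symm), hg, S.C.h_q, S.C.N_q]
    · intro c₀ c₁ c₂ c₃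
      have hs := S.σ_sq x
      obtain ⟨v, h0, h1, h2, h3⟩ := S.indepAB x c₀ (S.σ x * (c₀ - c₁) / δ)
        (S.σ x * (c₂ - c₀) / δ) ((c₃ - S.σ x * c₀) / δ ^ 2)
      refine ⟨v, by rw [T, if_pos (hx.trans hy.symm), h0], ?_, ?_, ?_⟩
      · simp only [S.h_special hx, AffineMap.add_linear, AffineMap.smul_linear,
          LinearMap.add_apply, LinearMap.smul_apply, h0, h1, smul_eq_mul]
        field_simp
        linear_combination (c₁ - c₀) * hs
      · simp only [S.h_special hy, AffineMap.add_linear, AffineMap.smul_linear,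
          LinearMap.add_apply, LinearMap.smul_apply, S.A_swap x y hxy (hx.trans hy.symm), hσ,
          h0, h2, smul_eq_mul]
        field_simp
        linear_combination (c₂ - c₀) * hs
      · simp only [hg, AffineMap.add_linear, AffineMap.smul_linear,
          LinearMap.add_apply, LinearMap.smul_apply, h0, h3, smul_eq_mul]
        field_simp
        ring

theorem strict_special_singleton [Finite Λ] {x y : Λ} (hx : S.π x = S.a) (hy : S.a ≠ S.π y) :
    ∀ᶠ δ in 𝓝[>] (0 : ℝ), StrictSep (S.q δ) (S.p δ) (S.h δ) S.T {x} {y} := by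
  let g : ℝ → Aff4 := fun δ =>
    S.g (S.π y) + (-δ) • AffineMap.const ℝ E4 (1 : ℝ) + (δ * S.σ x) • S.h δ x
  have hg : AffTendsto g (S.g (S.π y)) :=
    ((AffTendsto.const _).add_small (AffTendsto.const _)
      (tendsto_zero_of_continuous (by fun_prop) (by simp))).add_small (S.h_tendsto x)
      (tendsto_zero_of_continuous (by fun_prop) (by simp))
  have hxy : S.π x ≠ S.π y := hx ▸ hy
  have hyb : ∀ {w}, w ≠ y → S.π w ≠ S.π y := fun hw h => hy (S.fiber_special hw h).symm
  have k1 : ∀ᶠ δ in 𝓝[>] (0 : ℝ), 0 < g δ (S.q δ x) :=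
    (hg _ _ (S.q_tendsto x)).eventually_const_lt (by rw [hx]; exact S.g_qa _ hy)
  have k2 : ∀ᶠ δ in 𝓝[>] (0 : ℝ), g δ (S.q δ y) < 0 :=
    (hg _ _ (S.q_tendsto y)).eventually_lt_const (S.g_qb _ hy)
  have k3 : ∀ᶠ δ in 𝓝[>] (0 : ℝ), ∀ w, w ≠ y → x ≠ w → 0 < g δ (S.p δ x w) := by
    simp only [eventually_all]
    intro w hw hxw
    by_cases h0 : S.π x = S.π w
    · simp only [S.p_fiber h0]
      exact (hg _ _ tendsto_const_nhds).eventually_const_lt (S.g_qa _ hy)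
    · refine (hg _ _ (S.p_tendsto h0)).eventually_const_lt ?_
      rw [hx] at h0 ⊢
      exact S.g_pa _ hy _ (hyb hw) h0
  have k4 : ∀ᶠ δ in 𝓝[>] (0 : ℝ), ∀ w, w ≠ x → y ≠ w → g δ (S.p δ y w) < 0 := by
    simp only [eventually_all]
    intro w hw hyw
    have h0 := (hyb hyw.symm).symm
    by_cases hwa : S.π w = S.a
    · have hp := S.p_tendsto h0.symm
      rw [hwa] at hp
      filter_upwards [self_mem_nhdsWithin, S.h_p hyw.symm, S.g_p hwa hy,
        (((AffTendsto.const (S.A w)).add (AffTendsto.const (S.A x))) _ _ hp).eventually_const_lt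
          (add_pos (S.A_p w _ hy) (S.A_p x _ hy))] with δ (hδ : 0 < δ) e1 e2 e3
      rw [S.h_special hwa, S.σ_neg x w hw.symm (hx.trans hwa.symm)] at e1
      simp only [AffineMap.coe_add, AffineMap.coe_smul, Pi.add_apply, Pi.smul_apply,
        smul_eq_mul] at e1 e3
      have hs := S.σ_sq x
      rw [S.p_symm]
      have : g δ (S.p δ w y) = -(δ ^ 2 * (S.A w (S.p δ w y) + S.A x (S.p δ w y))) := by
        simp only [g, AffineMap.coe_add, AffineMap.coe_smul, Pi.add_apply, Pi.smul_apply,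
          smul_eq_mul, AffineMap.const_apply, e2, S.h_special hx]
        linear_combination (δ * S.σ x) * e1 -
          δ ^ 2 * (S.A w (S.p δ w y) + S.A x (S.p δ w y)) * hs
      rw [this]
      have := mul_pos (pow_pos hδ 2) e3
      linarith
    · exact (hg _ _ (S.p_tendsto h0)).eventually_lt_const (S.g_pb _ hy _ hwa h0)
  have k5 : ∀ᶠ δ in 𝓝[>] (0 : ℝ), Indep4 (S.T x y) (S.h δ x) (S.h δ y) (g δ) := by
    have hT : S.T x y = S.C.T S.a (S.π y) := by rw [T, if_neg hxy, hx]
    rw [hT]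
    exact Indep4.eventually (S.g_indep _ hy) (.const _) (hx ▸ S.h_tendsto x) (S.h_tendsto y) hg
  filter_upwards [k1, k2, k3, k4, k5, S.g_p hx hy, S.h_p (ne_of_apply_ne S.π hxy)]
    with δ k1 k2 k3 k4 k5 k6 k7
  refine ⟨g δ, by simpa using k1, by simpa using k2, ?_, ?_, ?_⟩
  · rintro _ rfl
    exact k3
  · rintro _ rfl
    exact k4
  · simp only [Set.mem_singleton_iff, forall_eq]
    refine ⟨fun _ _ => ⟨?_, k5⟩, fun _ h => absurd rfl h, fun h => absurd rfl h⟩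
    simp [g, k6, k7]

theorem strict_fiber_singleton [Finite Λ] {y : Λ} (hy : S.a ≠ S.π y) :
    ∀ᶠ δ in 𝓝[>] (0 : ℝ), StrictSep (S.q δ) (S.p δ) (S.h δ) S.T (S.π ⁻¹' {S.a}) {y} := by
  have hyb : ∀ {w}, w ≠ y → S.π w ≠ S.π y := fun hw h => hy (S.fiber_special hw h).symm
  have k1 : ∀ᶠ δ in 𝓝[>] (0 : ℝ), ∀ x ∈ S.π ⁻¹' {S.a}, 0 < S.g (S.π y) (S.q δ x) := by
    simp only [eventually_all]
    intro x hx
    refine (AffTendsto.const _ _ _ (S.q_tendsto x)).eventually_const_lt ?_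
    rw [show S.π x = S.a from hx]
    exact S.g_qa _ hy
  have k2 : ∀ᶠ δ in 𝓝[>] (0 : ℝ), S.g (S.π y) (S.q δ y) < 0 :=
    (AffTendsto.const _ _ _ (S.q_tendsto y)).eventually_lt_const (S.g_qb _ hy)
  have k3 : ∀ᶠ δ in 𝓝[>] (0 : ℝ), ∀ x ∈ S.π ⁻¹' {S.a}, ∀ w, w ≠ y → x ≠ w →
      0 < S.g (S.π y) (S.p δ x w) := by
    simp only [eventually_all]
    intro x hx w hw hxw
    by_cases h0 : S.π x = S.π w
    · simpa only [S.p_fiber h0] using .of_forall fun _ => S.g_qa _ hy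
    · refine (AffTendsto.const _ _ _ (S.p_tendsto h0)).eventually_const_lt ?_
      rw [show S.π x = S.a from hx] at h0 ⊢
      exact S.g_pa _ hy _ (hyb hw) h0
  have k4 : ∀ᶠ δ in 𝓝[>] (0 : ℝ), ∀ w, S.π w ≠ S.a → y ≠ w →
      S.g (S.π y) (S.p δ y w) < 0 := by
    simp only [eventually_all]
    intro w hwa hyw
    have h0 := (hyb hyw.symm).symm
    exact (AffTendsto.const _ _ _ (S.p_tendsto h0)).eventually_lt_const (S.g_pb _ hy _ hwa h0)
  have k5 : ∀ᶠ δ in 𝓝[>] (0 : ℝ), ∀ x ∈ S.π ⁻¹' {S.a}, S.g (S.π y) (S.p δ x y) = δ := by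
    simp only [eventually_all]
    exact fun x hx => S.g_p hx hy
  filter_upwards [k1, k2, k3, k4, k5, self_mem_nhdsWithin] with δ k1 k2 k3 k4 k5 (hδ : 0 < δ)
  refine ⟨S.g (S.π y), k1, by simpa using k2, k3, ?_, ?_⟩
  · rintro _ rfl
    exact k4
  · rintro x hx _ rfl
    refine ⟨fun h => absurd h.symm (S.nontriv x), fun _ h => absurd rfl h, fun _ _ => ?_⟩
    rw [k5 x hx]
    exact hδ

theorem strict_half [Finite Λ] {g : Aff4} {D' E' : Set Λ'} {D E : Set Λ} (hD : D ⊆ S.π ⁻¹' D')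
    (hE : ∀ w ∉ E, S.π w ∈ E' → S.π w = S.a ∧ E' = {S.a}) (hE' : E' = {S.a} → ∀ b, D' ≠ {b})
    (h1 : ∀ a ∈ D', 0 < g (S.C.q a)) (h2 : ∀ a ∈ D', ∀ x ∉ E', a ≠ x → 0 < g (S.C.p a x))
    (h3 : ∀ a ∈ D', ∀ b ∈ E', D' ≠ {a} → E' = {b} → 0 < g (S.C.p a b)) :
    ∀ᶠ δ in 𝓝[>] (0 : ℝ), (∀ x ∈ D, 0 < g (S.q δ x)) ∧
      ∀ x ∈ D, ∀ w ∉ E, x ≠ w → 0 < g (S.p δ x w) := by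
  simp only [eventually_and, eventually_all]
  refine ⟨fun x hx => (AffTendsto.const g _ _ (S.q_tendsto x)).eventually_const_lt (h1 _ (hD hx)),
    fun x hx w hw hxw => ?_⟩
  by_cases h0 : S.π x = S.π w
  · refine .of_forall fun δ => ?_
    rw [S.p_fiber h0]
    exact h1 _ (S.fiber _ _ hxw h0 ▸ hD hx)
  refine (AffTendsto.const g _ _ (S.p_tendsto h0)).eventually_const_lt ?_
  by_cases hwE : S.π w ∈ E'
  · obtain ⟨e1, e2⟩ := hE w hw hwE
    exact h3 _ (hD hx) _ hwE (hE' e2 _) (e1 ▸ e2)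
  · exact h2 _ (hD hx) _ hwE h0

/-- `D` is the preimage of `D'`, or a singleton of the special fibre with `D'` its image. -/
def Lifts (D : Set Λ) (D' : Set Λ') : Prop :=
  D = S.π ⁻¹' D' ∨ D' = {S.a} ∧ ∃ x, S.π x = S.a ∧ D = {x}

variable {S}

theorem Lifts.subset {D : Set Λ} {D' : Set Λ'} (h : S.Lifts D D') : D ⊆ S.π ⁻¹' D' := by
  rcases h with rfl | ⟨rfl, x, hx, rfl⟩
  · rfl
  · simpa using hx

theorem Lifts.of_notMem {D : Set Λ} {D' : Set Λ'} (h : S.Lifts D D') {w : Λ} (hw : w ∉ D)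
    (hw' : S.π w ∈ D') : S.π w = S.a ∧ D' = {S.a} := by
  rcases h with rfl | ⟨rfl, x, hx, rfl⟩
  · exact absurd hw' hw
  · exact ⟨hw', rfl⟩

theorem Lifts.eq_singleton {D : Set Λ} {D' : Set Λ'} (h : S.Lifts D D') {x : Λ} (hD : D = {x}) :
    D' = {S.π x} := by
  rcases h with rfl | ⟨rfl, y, hy, rfl⟩
  · rw [← S.surj.image_preimage D', hD, Set.image_singleton]
  · rw [← Set.singleton_injective hD, hy]

theorem preimage_singleton {b : Λ} (hb : S.π b ≠ S.a) : S.π ⁻¹' {S.π b} = {b} := by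
  ext w
  refine ⟨fun h => ?_, fun h => congrArg S.π h⟩
  by_contra hw
  exact hb (S.fiber_special hw h)

theorem Lifts.of_ne_singleton {D : Set Λ} {D' : Set Λ'} (h : S.Lifts D D') {x : Λ}
    (hD : D ≠ {x}) (hD' : D' = {S.π x}) : D' = {S.a} := by
  rcases h with rfl | ⟨h, -⟩
  · by_contra hne
    subst hD'
    exact hD (preimage_singleton fun h => hne (by rw [h]))
  · exact h

variable (S)

theorem strict_lift [Finite Λ] {D' E' : Set Λ'} {D E : Set Λ} (hD' : D' ∈ 𝓓) (hE' : E' ∈ 𝓓)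
    (hDE : Disjoint D' E') (hD : S.Lifts D D') (hE : S.Lifts E E')
    (hDa : D' = {S.a} → ∀ b, E' ≠ {b}) (hEa : E' = {S.a} → ∀ b, D' ≠ {b}) :
    ∀ᶠ δ in 𝓝[>] (0 : ℝ), StrictSep (S.q δ) (S.p δ) (S.h δ) S.T D E := by
  obtain ⟨g, h1, h2, h3, h4, h5⟩ := S.C.strict D' hD' E' hE' hDE
  have k1 := S.strict_half hD.subset (fun w => hE.of_notMem) hEa h1 h3
    fun a ha b hb => (h5 a ha b hb).2.2
  have k2 := S.strict_half (g := -g) hE.subset (fun w => hD.of_notMem) hDa (by simpa using h2)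
    (by simpa using h4) fun b hb a ha e1 e2 => by
      have := (h5 a ha b hb).2.1 e2 e1
      rw [S.C.p_symm] at this
      simpa using this
  have hne : ∀ x ∈ D, ∀ y ∈ E, S.π x ≠ S.π y := fun x hx y hy h =>
    Set.disjoint_left.1 hDE (hD.subset hx) (h ▸ hE.subset hy)
  have k3 : ∀ᶠ δ in 𝓝[>] (0 : ℝ), ∀ x ∈ D, ∀ y ∈ E, D = {x} → E ≠ {y} → g (S.p δ x y) < 0 := by
    simp only [eventually_all]
    intro x hx y hy e1 e2
    refine (AffTendsto.const g _ _ (S.p_tendsto (hne x hx y hy))).eventually_lt_const ?_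
    refine (h5 _ (hD.subset hx) _ (hE.subset hy)).2.1 (hD.eq_singleton e1) fun e3 => ?_
    exact hEa (hE.of_ne_singleton e2 e3) _ (hD.eq_singleton e1)
  have k4 : ∀ᶠ δ in 𝓝[>] (0 : ℝ), ∀ x ∈ D, ∀ y ∈ E, D ≠ {x} → E = {y} → 0 < g (S.p δ x y) := by
    simp only [eventually_all]
    intro x hx y hy e1 e2
    refine (AffTendsto.const g _ _ (S.p_tendsto (hne x hx y hy))).eventually_const_lt ?_
    refine (h5 _ (hD.subset hx) _ (hE.subset hy)).2.2 (fun e3 => ?_) (hE.eq_singleton e2)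
    exact hDa (hD.of_ne_singleton e1 e3) _ (hE.eq_singleton e2)
  filter_upwards [k1, k2, k3, k4] with δ k1 k2 k3 k4
  refine ⟨g, k1.1, by simpa using k2.1, k1.2, by simpa using k2.2, fun x hx y hy =>
    ⟨fun e1 e2 => ?_, k3 x hx y hy, k4 x hx y hy⟩⟩
  have d1 := hD.eq_singleton e1
  have d2 := hE.eq_singleton e2
  have hxa : S.π x ≠ S.a := fun h => hDa (by rw [d1, h]) _ d2
  have hya : S.π y ≠ S.a := fun h => hEa (by rw [d2, h]) _ d1
  simpa [p, T, h, hne x hx y hy, hxa, hya] using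
    (h5 _ (hD.subset hx) _ (hE.subset hy)).1 d1 d2

theorem disjoint_of_lifts {D' E' : Set Λ'} {D E : Set Λ} (hDE : Disjoint D E)
    (hD : S.Lifts D D') (hE : S.Lifts E E') (h : D' = {S.a} → E' ≠ {S.a}) : Disjoint D' E' := by
  rw [Set.disjoint_left]
  intro b hbD hbE
  obtain ⟨y, rfl⟩ := S.surj b
  have key : ∀ {D' E' : Set Λ'} {D E : Set Λ}, Disjoint D E → S.Lifts D D' → S.Lifts E E' →
      S.π y ∈ D' → S.π y ∈ E' → y ∉ D → D' = {S.a} ∧ E' = {S.a} := by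
    intro D' E' D E hDE hD hE hbD hbE hy
    obtain ⟨hya, hDa⟩ := hD.of_notMem hy hbD
    refine ⟨hDa, ?_⟩
    rcases hE with rfl | ⟨hE, -⟩
    · rcases hD with rfl | ⟨-, x, hx, rfl⟩
      · exact absurd hbD hy
      · rw [hya] at hbE
        exact absurd (show S.π x ∈ E' from hx ▸ hbE) (Set.disjoint_left.1 hDE rfl)
    · exact hE
  by_cases hy : y ∈ D
  · obtain ⟨e1, e2⟩ := key hDE.symm hE hD hbE hbD (Set.disjoint_left.1 hDE hy)
    exact h e2 e1
  · obtain ⟨e1, e2⟩ := key hDE hD hE hbD hbE hy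
    exact h e1 e2

theorem strict [Finite Λ] {D' E' : Set Λ'} {D E : Set Λ} (hD' : D' ∈ 𝓓) (hE' : E' ∈ 𝓓)
    (hDE : Disjoint D E) (hD : S.Lifts D D') (hE : S.Lifts E E') :
    ∀ᶠ δ in 𝓝[>] (0 : ℝ), StrictSep (S.q δ) (S.p δ) (S.h δ) S.T D E := by
  have main : ∀ {D' E' : Set Λ'} {D E : Set Λ}, D' = {S.a} → Disjoint D E → S.Lifts D D' →
      S.Lifts E E' → ∀ b, E' = {b} →
      ∀ᶠ δ in 𝓝[>] (0 : ℝ), StrictSep (S.q δ) (S.p δ) (S.h δ) S.T D E := by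
    intro D' E' D E hDa hDE hD hE b hb
    obtain ⟨y, rfl⟩ := S.surj b
    by_cases hya : S.π y = S.a
    · rw [hya] at hb
      subst hDa hb
      rcases hD with rfl | ⟨-, x, hx, rfl⟩
      · obtain ⟨z, hz⟩ : E.Nonempty := by
          rcases hE with rfl | ⟨-, z, -, rfl⟩
          exacts [⟨y, hya⟩, ⟨z, rfl⟩]
        exact absurd (hE.subset hz) (Set.disjoint_right.1 hDE hz)
      · rcases hE with rfl | ⟨-, z, hz, rfl⟩
        · exact absurd hx (Set.disjoint_left.1 hDE rfl)
        · exact S.strict_special (by simpa using hDE) hx hz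
    · have hEy : E = {y} := by
        rcases hE with rfl | ⟨h, -⟩
        · rw [hb, preimage_singleton hya]
        · exact absurd (Set.singleton_injective (hb.symm.trans h)) hya
      subst hEy
      rcases hD with rfl | ⟨-, x, hx, rfl⟩
      · rw [hDa]
        exact S.strict_fiber_singleton (Ne.symm hya)
      · exact S.strict_special_singleton hx (Ne.symm hya)
  by_cases h1 : D' = {S.a} ∧ ∃ b, E' = {b}
  · obtain ⟨h1, b, hb⟩ := h1
    exact main h1 hDE hD hE b hb
  by_cases h2 : E' = {S.a} ∧ ∃ b, D' = {b}
  · obtain ⟨h2, b, hb⟩ := h2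
    exact (main h2 hDE.symm hE hD b hb).mono fun δ h => h.symm (S.p_symm δ) S.T_symm
  have h1' : D' = {S.a} → ∀ b, E' ≠ {b} := fun e b hb => h1 ⟨e, b, hb⟩
  have h2' : E' = {S.a} → ∀ b, D' ≠ {b} := fun e b hb => h2 ⟨e, b, hb⟩
  refine S.strict_lift hD' hE' (S.disjoint_of_lifts hDE hD hE ?_) hD hE h1' h2'
  rintro rfl rfl
  exact h1' rfl _ rfl

theorem weak_of_lifts [Finite Λ] {D' E' : Set Λ'} {D E : Set Λ} (hD' : D' ∈ 𝓓) (hE' : E' ∈ 𝓓)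
    (hDE : Disjoint D E) (hD : S.Lifts D D') (hE : S.Lifts E E') :
    ∀ᶠ δ in 𝓝[>] (0 : ℝ), WeakSep (S.q δ) (S.p δ) S.T D E := by
  by_cases h : D' = {S.a} ∧ E' = {S.a}
  · obtain ⟨rfl, rfl⟩ := h
    have hfib : ∃ z, S.π z = S.a := S.surj _
    rcases hD with rfl | ⟨-, x, hx, rfl⟩
    · obtain ⟨z, hz⟩ : E.Nonempty := by
        rcases hE with rfl | ⟨-, z, -, rfl⟩
        exacts [hfib, ⟨z, rfl⟩]
      exact absurd (hE.subset hz) (Set.disjoint_right.1 hDE hz)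
    · rcases hE with rfl | ⟨-, z, hz, rfl⟩
      · exact absurd hx (Set.disjoint_left.1 hDE rfl)
      · exact S.weak_special (by simpa using hDE) hx hz
  · exact S.weak hD' hE' (S.disjoint_of_lifts hDE hD hE fun e1 e2 => h ⟨e1, e2⟩) hD.subset hE.subset

theorem exists_contactSystem [Finite Λ] {𝓔 : Set (Set Λ)}
    (h𝓔 : ∀ D ∈ 𝓔, ∃ D' ∈ 𝓓, S.Lifts D D') : Nonempty (ContactSystem Λ 𝓔) := by
  have hs : ∀ᶠ δ in 𝓝[>] (0 : ℝ), ∀ D, D ∈ 𝓔 → ∀ E, E ∈ 𝓔 → Disjoint D E →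
      StrictSep (S.q δ) (S.p δ) (S.h δ) S.T D E := by
    simp only [eventually_all]
    intro D hD E hE hDE
    obtain ⟨D', hD', lD⟩ := h𝓔 D hD
    obtain ⟨E', hE', lE⟩ := h𝓔 E hE
    exact S.strict hD' hE' hDE lD lE
  have hw : ∀ᶠ δ in 𝓝[>] (0 : ℝ), ∀ D, D ∈ 𝓔 → ∀ E, E ∈ 𝓔 → Disjoint D E →
      WeakSep (S.q δ) (S.p δ) S.T D E := by
    simp only [eventually_all]
    intro D hD E hE hDE
    obtain ⟨D', hD', lD⟩ := h𝓔 D hD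
    obtain ⟨E', hE', lE⟩ := h𝓔 E hE
    exact S.weak_of_lifts hD' hE' hDE lD lE
  have hp : ∀ᶠ δ in 𝓝[>] (0 : ℝ), ∀ x y, x ≠ y → S.h δ x (S.p δ x y) = 0 ∧
      0 < S.L δ x (S.p δ x y) ∧ 0 < S.M δ x (S.p δ x y) ∧ S.T x y (S.p δ x y) = 0 := by
    simp only [eventually_all, eventually_and]
    exact fun x y hxy => ⟨S.h_p hxy, S.L_p hxy, S.M_p hxy, S.T_p x y⟩
  have hi : ∀ᶠ δ in 𝓝[>] (0 : ℝ), ∀ x, Indep4 (S.h δ x) (S.L δ x) (S.M δ x) (S.C.N (S.π x)) := by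
    simp only [eventually_all]
    exact S.indep
  obtain ⟨δ, hs, hw, hp, hi⟩ := (hs.and (hw.and (hp.and hi))).exists
  exact ⟨{
    q := S.q δ
    p := S.p δ
    h := S.h δ
    L := S.L δ
    M := S.M δ
    N := fun x => S.C.N (S.π x)
    T := S.T
    p_symm := S.p_symm δ
    T_symm := S.T_symm
    indep := hi
    h_q := fun x => S.q_h x δ
    L_q := fun x => S.q_L x δ
    M_q := fun x => S.q_M x δ
    N_q := fun x => S.q_N x δ
    h_p := fun x y hxy => (hp x y hxy).1
    L_p := fun x y hxy => (hp x y hxy).2.1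
    M_p := fun x y hxy => (hp x y hxy).2.2.1
    T_p := fun x y hxy => (hp x y hxy).2.2.2
    strict := fun D hD E hE => hs D hD E hE
    weak := fun D hD E hE => hw D hD E hE }⟩

end Splitting

open Classical in
/-- The map identifying `a₂` with `a₁`. -/
noncomputable def collapse {a₁ a₂ : Λ} (h : a₁ ≠ a₂) (x : Λ) : {x : Λ // x ≠ a₂} :=
  if hx : x = a₂ then ⟨a₁, h⟩ else ⟨x, hx⟩

theorem collapse_of_ne {a₁ a₂ : Λ} (h : a₁ ≠ a₂) {x : Λ} (hx : x ≠ a₂) :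
    collapse h x = ⟨x, hx⟩ := dif_neg hx

theorem collapse_self {a₁ a₂ : Λ} (h : a₁ ≠ a₂) : collapse h a₂ = ⟨a₁, h⟩ := dif_pos rfl

theorem eq_of_collapse_eq {a₁ a₂ : Λ} (h : a₁ ≠ a₂) {x y : Λ} (hxy : x ≠ y)
    (he : collapse h x = collapse h y) : x = a₂ ∧ y = a₁ ∨ x = a₁ ∧ y = a₂ := by
  by_cases hx : x = a₂ <;> by_cases hy : y = a₂
  · exact absurd (hx.trans hy.symm) hxy
  · subst hx
    rw [collapse_self, collapse_of_ne h hy, Subtype.mk.injEq] at he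
    exact .inl ⟨rfl, he.symm⟩
  · subst hy
    rw [collapse_self, collapse_of_ne h hx, Subtype.mk.injEq] at he
    exact .inr ⟨he, rfl⟩
  · rw [collapse_of_ne h hy, collapse_of_ne h hx, Subtype.mk.injEq] at he
    exact absurd he hxy

open Classical in
theorem ContactSystem.exists_splitting {a₁ a₂ : Λ} (h : a₁ ≠ a₂) {𝓓 : Set (Set {x : Λ // x ≠ a₂})}
    (C : ContactSystem {x : Λ // x ≠ a₂} 𝓓) (h𝓓 : ∀ b, {b} ∈ 𝓓) :
    ∃ S : Splitting Λ {x : Λ // x ≠ a₂} 𝓓, S.π = collapse h ∧ S.a = ⟨a₁, h⟩ := by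
  set a : {x : Λ // x ≠ a₂} := ⟨a₁, h⟩ with ha
  let A : Λ → Aff4 := fun x => if x = a₂ then C.M a else C.L a
  let B : Λ → Aff4 := fun x => if x = a₂ then C.L a else C.M a
  have hAB : ∀ x, Indep4 (C.h a) (A x) (B x) (C.N a) := by
    intro x
    by_cases hx : x = a₂
    · simp only [A, B, if_pos hx]
      intro c₀ c₁ c₂ c₃
      obtain ⟨v, h0, h1, h2, h3⟩ := C.indep a c₀ c₂ c₁ c₃
      exact ⟨v, h0, h2, h1, h3⟩
    · simp only [A, B, if_neg hx]
      exact C.indep a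
  have hg : ∀ b, ∃ g : Aff4, a ≠ b → 0 < g (C.q a) ∧ g (C.q b) < 0 ∧
      (∀ c, c ≠ b → a ≠ c → 0 < g (C.p a c)) ∧ (∀ c, c ≠ a → b ≠ c → g (C.p b c) < 0) ∧
      g (C.p a b) = 0 ∧ Indep4 (C.T a b) (C.h a) (C.h b) g := by
    intro b
    by_cases hab : a = b
    · exact ⟨0, fun hne => absurd hab hne⟩
    obtain ⟨g, h1, h2, h3, h4, h5⟩ := C.strict _ (h𝓓 a) _ (h𝓓 b) (by simpa using hab)
    obtain ⟨h6, h7⟩ := (h5 a rfl b rfl).1 rfl rfl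
    exact ⟨g, fun _ => ⟨h1 a rfl, h2 b rfl, h3 a rfl, h4 b rfl, h6, h7⟩⟩
  choose g hg using hg
  have hu : ∀ b, ∃ u, a ≠ b → (C.T a b).linear u = 0 ∧ (C.h a).linear u = 1 ∧
      (C.h b).linear u = 0 ∧ (g b).linear u = 0 := by
    intro b
    by_cases hab : a = b
    · exact ⟨0, fun hne => absurd hab hne⟩
    obtain ⟨u, hu⟩ := (hg b hab).2.2.2.2.2 0 1 0 0
    exact ⟨u, fun _ => hu⟩
  have hv : ∀ b, ∃ v, a ≠ b → (C.T a b).linear v = 0 ∧ (C.h a).linear v = 0 ∧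
      (C.h b).linear v = 0 ∧ (g b).linear v = 1 := by
    intro b
    by_cases hab : a = b
    · exact ⟨0, fun hne => absurd hab hne⟩
    obtain ⟨v, hv⟩ := (hg b hab).2.2.2.2.2 0 0 0 1
    exact ⟨v, fun _ => hv⟩
  choose u hu using hu
  choose v hv using hv
  choose e he using fun x => hAB x 0 1 0 0
  choose e' he' using fun x => hAB x 0 0 1 0
  choose eh heh using fun x => hAB x 1 0 0 0
  refine ⟨{
    C := C
    π := collapse h
    a := a
    σ := fun x => if x = a₂ then -1 else 1
    surj := fun b => ⟨b, collapse_of_ne h b.2⟩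
    fiber := fun x y hxy hp => ?_
    nontriv := fun x hx => ?_
    σ_sq := fun x => by split_ifs <;> norm_num
    σ_neg := fun x y hxy hp => ?_
    A := A
    B := B
    A_swap := fun x y hxy hp => ?_
    A_q := fun x => ?_
    B_q := fun x => ?_
    A_p := fun x b hb => ?_
    B_p := fun x b hb => ?_
    indepAB := hAB
    e := e
    e' := e'
    eh := eh
    he := he
    he' := he'
    heh := heh
    g := g
    g_qa := fun b hb => (hg b hb).1
    g_qb := fun b hb => (hg b hb).2.1
    g_pa := fun b hb => (hg b hb).2.2.1
    g_pb := fun b hb => (hg b hb).2.2.2.1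
    g_ab := fun b hb => (hg b hb).2.2.2.2.1
    g_indep := fun b hb => (hg b hb).2.2.2.2.2
    u := u
    v := v
    hu := hu
    hv := hv }, rfl, rfl⟩
  · rcases eq_of_collapse_eq h hxy hp with ⟨rfl, -⟩ | ⟨rfl, -⟩
    exacts [collapse_self h, collapse_of_ne h h]
  · have h1 : a₁ ∈ collapse h ⁻¹' {a} := collapse_of_ne h h
    have h2 : a₂ ∈ collapse h ⁻¹' {a} := collapse_self h
    rw [← hx] at h1 h2
    exact h (h1.trans h2.symm)
  · rcases eq_of_collapse_eq h hxy hp with ⟨rfl, rfl⟩ | ⟨rfl, rfl⟩ <;> simp [h]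
  · rcases eq_of_collapse_eq h hxy hp with ⟨rfl, rfl⟩ | ⟨rfl, rfl⟩ <;> simp [h, A, B]
  · simp only [A]
    split_ifs
    exacts [C.M_q a, C.L_q a]
  · simp only [B]
    split_ifs
    exacts [C.L_q a, C.M_q a]
  · simp only [A]
    split_ifs
    exacts [C.M_p a b hb, C.L_p a b hb]
  · simp only [B]
    split_ifs
    exacts [C.L_p a b hb, C.M_p a b hb]

/-- A family of nonempty sets, any two of which are nested or disjoint. -/
def Laminar (𝓓 : Set (Set Λ)) : Prop :=
  (∀ D ∈ 𝓓, D.Nonempty) ∧ ∀ D ∈ 𝓓, ∀ E ∈ 𝓓, D ⊆ E ∨ E ⊆ D ∨ Disjoint D E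

theorem Laminar.union_singletons {𝓓 : Set (Set Λ)} (h𝓓 : Laminar 𝓓) :
    Laminar (𝓓 ∪ {D | ∃ b, D = {b}}) := by
  have hs : ∀ (b : Λ) (E : Set Λ), {b} ⊆ E ∨ Disjoint {b} E := fun b E =>
    (em (b ∈ E)).imp Set.singleton_subset_iff.2 Set.disjoint_singleton_left.2
  refine ⟨?_, ?_⟩
  · rintro D (hD | ⟨b, rfl⟩)
    exacts [h𝓓.1 D hD, Set.singleton_nonempty b]
  · rintro D (hD | ⟨b, rfl⟩) E (hE | ⟨c, rfl⟩)
    · exact h𝓓.2 D hD E hE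
    · exact (hs c D).elim (fun h => .inr (.inl h)) fun h => .inr (.inr h.symm)
    · exact (hs b E).imp id .inr
    · exact (hs b {c}).imp id .inr

theorem ContactSystem.of_subsingleton [Subsingleton Λ] {𝓓 : Set (Set Λ)} (h𝓓 : Laminar 𝓓) :
    Nonempty (ContactSystem Λ 𝓓) := by
  let f : Fin 4 → Aff4 := fun i => (EuclideanSpace.proj (𝕜 := ℝ) i).toLinearMap.toAffineMap
  have hf : ∀ i, f i 0 = 0 := fun i => by simp [f]
  have hdis : ∀ D ∈ 𝓓, ∀ E ∈ 𝓓, ¬ Disjoint D E := by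
    intro D hD E hE hDE
    obtain ⟨x, hx⟩ := h𝓓.1 D hD
    obtain ⟨y, hy⟩ := h𝓓.1 E hE
    exact Set.disjoint_left.1 hDE hx (Subsingleton.elim y x ▸ hy)
  exact ⟨{
    q := fun _ => 0
    p := fun _ _ => 0
    h := fun _ => f 0
    L := fun _ => f 1
    M := fun _ => f 2
    N := fun _ => f 3
    T := fun _ _ => 0
    p_symm := fun _ _ => rfl
    T_symm := fun _ _ => rfl
    indep := fun _ c₀ c₁ c₂ c₃ => ⟨!₂[c₀, c₁, c₂, c₃], rfl, rfl, rfl, rfl⟩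
    h_q := fun _ => hf 0
    L_q := fun _ => hf 1
    M_q := fun _ => hf 2
    N_q := fun _ => hf 3
    h_p := fun _ _ _ => hf 0
    L_p := fun a b hab => absurd (Subsingleton.elim a b) hab
    M_p := fun a b hab => absurd (Subsingleton.elim a b) hab
    T_p := fun a b hab => absurd (Subsingleton.elim a b) hab
    strict := fun D hD E hE hDE => absurd hDE (hdis D hD E hE)
    weak := fun D hD E hE hDE => absurd hDE (hdis D hD E hE) }⟩

theorem Laminar.exists_pair [Finite Λ] [Nontrivial Λ] {𝓓 : Set (Set Λ)} (h𝓓 : Laminar 𝓓) :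
    ∃ a₁ a₂ : Λ, a₁ ≠ a₂ ∧ ∀ D ∈ 𝓓, (a₁ ∈ D ↔ a₂ ∈ D) ∨ D = {a₁} ∨ D = {a₂} := by
  obtain ⟨D₀, ⟨hD₀, a₁, h₁, a₂, h₂, hne⟩, hmin⟩ :=
    Set.exists_min_image {D : Set Λ | (D ∈ 𝓓 ∨ D = Set.univ) ∧ D.Nontrivial} Set.ncard
      (Set.toFinite _) ⟨Set.univ, .inr rfl, Set.nontrivial_univ⟩
  refine ⟨a₁, a₂, hne, fun D hD => ?_⟩
  by_cases hn : D.Nontrivial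
  · left
    have hcard := hmin D ⟨.inl hD, hn⟩
    have hlam : D ⊆ D₀ ∨ D₀ ⊆ D ∨ Disjoint D D₀ := by
      rcases hD₀ with hD₀ | rfl
      exacts [h𝓓.2 D hD D₀ hD₀, .inl (Set.subset_univ _)]
    rcases hlam with h | h | h
    · rw [Set.eq_of_subset_of_ncard_le h hcard]
      exact iff_of_true h₁ h₂
    · exact iff_of_true (h h₁) (h h₂)
    · exact iff_of_false (Set.disjoint_right.1 h h₁) (Set.disjoint_right.1 h h₂)
  · rw [Set.not_nontrivial_iff] at hn
    by_cases h1 : a₁ ∈ D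
    · exact .inr (.inl (hn.eq_singleton_of_mem h1))
    · by_cases h2 : a₂ ∈ D
      · exact .inr (.inr (hn.eq_singleton_of_mem h2))
      · exact .inl (iff_of_false h1 h2)

theorem Laminar.nonempty_contactSystem (n : ℕ) : ∀ {Λ : Type} [Finite Λ], Nat.card Λ ≤ n →
    ∀ {𝓓 : Set (Set Λ)}, Laminar 𝓓 → Nonempty (ContactSystem Λ 𝓓) := by
  induction n with
  | zero =>
    intro Λ _ hn 𝓓 h𝓓
    have := (Finite.card_le_one_iff_subsingleton (α := Λ)).1 (hn.trans zero_le_one)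
    exact ContactSystem.of_subsingleton h𝓓
  | succ n ih =>
    intro Λ _ hn 𝓓 h𝓓
    rcases subsingleton_or_nontrivial Λ with hs | hs
    · exact ContactSystem.of_subsingleton h𝓓
    obtain ⟨a₁, a₂, h, hD⟩ := h𝓓.exists_pair
    have hsurj : Function.Surjective (collapse h) := fun b => ⟨b, collapse_of_ne h b.2⟩
    let 𝓓' : Set (Set {x : Λ // x ≠ a₂}) := {D | collapse h ⁻¹' D ∈ 𝓓} ∪ {D | ∃ b, D = {b}}
    have hlam : Laminar 𝓓' := by
      refine Laminar.union_singletons ⟨fun D hD => (h𝓓.1 _ hD).elim fun x hx => ⟨_, hx⟩,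
        fun D hD E hE => ?_⟩
      rcases h𝓓.2 _ hD _ hE with h | h | h
      · exact .inl (hsurj.preimage_subset_preimage_iff.1 h)
      · exact .inr (.inl (hsurj.preimage_subset_preimage_iff.1 h))
      · exact .inr (.inr (h.of_preimage hsurj))
    have hcard : Nat.card {x : Λ // x ≠ a₂} ≤ n := by
      have := Finite.card_subtype_lt (p := fun x : Λ => x ≠ a₂) (x := a₂) (by simp)
      lia
    obtain ⟨C⟩ := ih hcard hlam
    obtain ⟨S, hπ, ha⟩ := C.exists_splitting h fun b => .inr ⟨b, rfl⟩
    refine S.exists_contactSystem fun D hD' => ?_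
    unfold Splitting.Lifts
    rw [hπ, ha]
    rcases hD D hD' with hD | rfl | rfl
    · have key : D = collapse h ⁻¹' {b | (b : Λ) ∈ D} := by
        ext x
        by_cases hx : x = a₂
        · subst hx
          simp [collapse_self, hD]
        · simp [collapse_of_ne h hx]
      refine ⟨{b | (b : Λ) ∈ D}, .inl ?_, .inl key⟩
      rw [Set.mem_ofPred_eq, ← key]
      exact hD'
    · exact ⟨_, .inr ⟨_, rfl⟩, .inr ⟨rfl, a₁, collapse_of_ne h h, rfl⟩⟩
    · exact ⟨_, .inr ⟨_, rfl⟩, .inr ⟨rfl, a₂, collapse_self h, rfl⟩⟩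

section Body

open scoped Pointwise

/-- The convex hull of `P` and the translates of `ρ • W` by the points of `C`. -/
def body (W C P : Set E4) (ρ : ℝ) : Set E4 := convexHull ℝ ((C + ρ • W) ∪ P)

variable {W C P C' P' : Set E4} {ρ ρ' : ℝ}

theorem add_smul_interior_subset (hρ : 0 < ρ) {c : E4} (hc : c ∈ C) :
    {c} + ρ • interior (convexHull ℝ W) ⊆ interior (body W C P ρ) := by
  refine interior_maximal ?_ ((isOpen_interior.smul₀ hρ.ne').add_left)
  have h : {c} + ρ • convexHull ℝ W ⊆ body W C P ρ := by
    rw [← convexHull_smul, ← convexHull_singleton (𝕜 := ℝ) c, ← convexHull_add]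
    exact convexHull_mono ((Set.add_subset_add_right (Set.singleton_subset_iff.2 hc)).trans
      Set.subset_union_left)
  exact (Set.add_subset_add_left (Set.smul_set_mono interior_subset)).trans h

theorem mem_interior_body (hW : 0 ∈ interior (convexHull ℝ W)) (hρ : 0 < ρ) {c : E4}
    (hc : c ∈ C) : c ∈ interior (body W C P ρ) :=
  add_smul_interior_subset hρ hc ⟨c, rfl, 0, ⟨0, hW, smul_zero _⟩, add_zero _⟩

theorem add_smul_mem_interior_body (hW : 0 ∈ interior (convexHull ℝ W)) (hρ : 0 < ρ)
    (hρ' : ρ < ρ') {c w : E4} (hc : c ∈ C) (hw : w ∈ W) : c + ρ • w ∈ interior (body W C P ρ') := by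
  have h0 : 0 < ρ' := hρ.trans hρ'
  refine add_smul_interior_subset h0 hc ⟨c, rfl, ρ • w, ⟨(ρ / ρ') • w, ?_, ?_⟩, rfl⟩
  · have := (convex_convexHull ℝ W).combo_interior_self_mem_interior hW
      (subset_convexHull ℝ W hw) (a := 1 - ρ / ρ') (b := ρ / ρ')
      (by rw [sub_pos, div_lt_one h0]; exact hρ') (by positivity) (by ring)
    simpa using this
  · change ρ' • (ρ / ρ') • w = ρ • w
    rw [smul_smul, mul_div_cancel₀ _ h0.ne']

theorem body_subset (hW : 0 ∈ interior (convexHull ℝ W)) (hρ : 0 < ρ) (hρ' : ρ ≤ ρ')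
    (hC : C ⊆ C') (hP : P ⊆ C' ∪ P') : body W C P ρ ⊆ body W C' P' ρ' := by
  refine convexHull_min (Set.union_subset ?_ fun z hz => ?_) (convex_convexHull ℝ _)
  · rintro _ ⟨c, hc, _, ⟨w, hw, rfl⟩, rfl⟩
    rcases hρ'.eq_or_lt with rfl | hlt
    · exact subset_convexHull ℝ _ (.inl ⟨c, hC hc, _, ⟨w, hw, rfl⟩, rfl⟩)
    · exact interior_subset (add_smul_mem_interior_body hW hρ hlt (hC hc) hw)
  · rcases hP hz with h | h
    · exact interior_subset (mem_interior_body hW (hρ.trans_le hρ') h)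
    · exact subset_convexHull ℝ _ (.inr h)

theorem body_subset_interior (hW : 0 ∈ interior (convexHull ℝ W)) (hρ : 0 < ρ) (hρ' : ρ < ρ')
    (hC : C ⊆ C') (hP : P ⊆ C') : body W C P ρ ⊆ interior (body W C' P' ρ') := by
  refine convexHull_min (Set.union_subset ?_ fun z hz => ?_) (convex_convexHull ℝ _).interior
  · rintro _ ⟨c, hc, _, ⟨w, hw, rfl⟩, rfl⟩
    exact add_smul_mem_interior_body hW hρ hρ' (hC hc) hw
  · exact mem_interior_body hW (hρ.trans hρ') (hP hz)

theorem regClosed_body (hW : 0 ∈ interior (convexHull ℝ W)) (hρ : 0 < ρ) (hWf : W.Finite)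
    (hCf : C.Finite) (hPf : P.Finite) (hC : C.Nonempty) : RegClosed (body W C P ρ) := by
  obtain ⟨c, hc⟩ := hC
  have hcl : IsClosed (body W C P ρ) :=
    ((hCf.add hWf.smul_set).union hPf).isClosed_convexHull ℝ
  exact ((convex_convexHull ℝ _).closure_interior_eq_closure_of_nonempty_interior
    ⟨c, mem_interior_body hW hρ hc⟩).trans hcl.closure_eq

theorem Aff4.eventually_pos {g : Aff4} (hW : W.Finite) (hC : C.Finite) (n : ℝ)
    (hg : ∀ c ∈ C, 0 < g c) : ∀ᶠ ε in 𝓝[>] (0 : ℝ), ∀ x ∈ C + (ε * n) • W, 0 < g x := by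
  have : ∀ᶠ ε in 𝓝[>] (0 : ℝ), ∀ c ∈ C, ∀ w ∈ W, 0 < g (c + (ε * n) • w) := by
    rw [eventually_all_finite hC]
    intro c hc
    rw [eventually_all_finite hW]
    intro w _
    have hcont : Continuous fun ε : ℝ => g (c + (ε * n) • w) :=
      g.continuous_of_finiteDimensional.comp (by fun_prop)
    have := hcont.tendsto 0
    simp only [zero_mul, zero_smul, add_zero] at this
    exact (tendsto_nhdsWithin_of_tendsto_nhds this).eventually_const_lt (hg c hc)
  filter_upwards [this] with ε hε
  rintro _ ⟨c, hc, _, ⟨w, hw, rfl⟩, rfl⟩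
  exact hε c hc w hw

theorem Aff4.pos_on_body {g : Aff4} (h : ∀ x ∈ C + ρ • W, 0 < g x) (hP : ∀ x ∈ P, 0 < g x) :
    ∀ x ∈ body W C P ρ, 0 < g x :=
  convexHull_min (t := g ⁻¹' Set.Ioi 0)
    (Set.union_subset h hP) ((convex_Ioi (0 : ℝ)).affine_preimage g)

theorem Aff4.nonneg_on_body {g : Aff4} (h : ∀ x ∈ C + ρ • W, 0 < g x) (hP : ∀ x ∈ P, 0 ≤ g x) :
    ∀ x ∈ body W C P ρ, 0 ≤ g x :=
  convexHull_min (t := g ⁻¹' Set.Ici 0)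
    (Set.union_subset (fun x hx => (h x hx).le) hP) ((convex_Ici (0 : ℝ)).affine_preimage g)

theorem Aff4.pos_of_mem_interior {g : Aff4} {B : Set E4} (hg : ∀ x ∈ B, 0 ≤ g x) {c x : E4}
    (hc : 0 < g c) (hx : x ∈ interior B) : 0 < g x := by
  by_contra hle
  have hx0 : g x = 0 := le_antisymm (not_lt.1 hle) (hg x (interior_subset hx))
  have hcont : Continuous fun s : ℝ => AffineMap.lineMap x c s := AffineMap.lineMap_continuous
  have ht := hcont.tendsto 0
  rw [AffineMap.lineMap_apply_zero] at ht
  have hev := (tendsto_nhdsWithin_of_tendsto_nhds (s := Set.Iio 0) ht).eventually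
    (mem_interior_iff_mem_nhds.1 hx)
  obtain ⟨s, hs, hs0⟩ := (hev.and self_mem_nhdsWithin).exists
  have h1 := hg _ hs
  rw [AffineMap.apply_lineMap, AffineMap.lineMap_apply, hx0] at h1
  have h2 : s * g c < 0 := mul_neg_of_neg_of_pos hs0 hc
  simp at h1
  linarith

end Body

section Region

variable {𝓓 : Set (Set Λ)}

namespace ContactSystem

variable (C : ContactSystem Λ 𝓓) (G : Λ → Λ → Prop)

/-- The points of `D` and the contact points between members of `D`. -/
def core (D : Set Λ) : Set E4 := C.q '' D ∪ {z | ∃ a ∈ D, ∃ b ∈ D, G a b ∧ C.p a b = z}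

/-- The contact points between members and non-members of `D`. -/
def tips (D : Set Λ) : Set E4 := {z | ∃ a ∈ D, ∃ b ∉ D, G a b ∧ C.p a b = z}

/-- The convex region associated with `D`, thickened by `W` at its core. -/
def region (W : Set E4) (ε : ℝ) (D : Set Λ) : Set E4 :=
  body W (C.core G D) (C.tips G D) (ε * D.ncard)

variable {G}

theorem finite_core [Finite Λ] (D : Set Λ) : (C.core G D).Finite := by
  refine ((Set.finite_range C.q).union (Set.finite_range (fun x : Λ × Λ => C.p x.1 x.2))).subset ?_
  rintro _ (⟨a, -, rfl⟩ | ⟨a, -, b, -, -, rfl⟩)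
  exacts [.inl ⟨a, rfl⟩, .inr ⟨(a, b), rfl⟩]

theorem finite_tips [Finite Λ] (D : Set Λ) : (C.tips G D).Finite := by
  refine (Set.finite_range (fun x : Λ × Λ => C.p x.1 x.2)).subset ?_
  rintro _ ⟨a, -, b, -, -, rfl⟩
  exact ⟨(a, b), rfl⟩

theorem core_mono {D E : Set Λ} (h : D ⊆ E) : C.core G D ⊆ C.core G E := by
  rintro _ (⟨a, ha, rfl⟩ | ⟨a, ha, b, hb, hab, rfl⟩)
  exacts [.inl ⟨a, h ha, rfl⟩, .inr ⟨a, h ha, b, h hb, hab, rfl⟩]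

theorem tips_subset {D E : Set Λ} (h : D ⊆ E) : C.tips G D ⊆ C.core G E ∪ C.tips G E := by
  rintro _ ⟨a, ha, b, -, hab, rfl⟩
  by_cases hbE : b ∈ E
  · exact .inl (.inr ⟨a, h ha, b, hbE, hab, rfl⟩)
  · exact .inr ⟨a, h ha, b, hbE, hab, rfl⟩

theorem weak_half_region [Finite Λ] (hG : ∀ a b, G a b → a ≠ b) {W : Set E4} (hW : W.Finite)
    {D : Set Λ} {t : Aff4} (h1 : ∀ a ∈ D, 0 < t (C.q a))
    (h2 : ∀ a ∈ D, ∀ x, a ≠ x → 0 < t (C.p a x) ∨ x ∉ D ∧ ∃ c : ℝ, t = c • C.T a x) :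
    ∀ᶠ ε in 𝓝[>] (0 : ℝ), ∀ x ∈ C.region G W ε D, 0 ≤ t x := by
  have hc : ∀ z ∈ C.core G D, 0 < t z := by
    rintro _ (⟨a, ha, rfl⟩ | ⟨a, ha, b, hb, hab, rfl⟩)
    · exact h1 a ha
    · exact (h2 a ha b (hG a b hab)).resolve_right fun h => h.1 hb
  filter_upwards [Aff4.eventually_pos hW (C.finite_core D) D.ncard hc] with ε hε
  refine Aff4.nonneg_on_body hε ?_
  rintro _ ⟨a, ha, b, -, hab, rfl⟩
  rcases h2 a ha b (hG a b hab) with h | ⟨-, c, rfl⟩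
  · exact h.le
  · simp [C.T_p a b (hG a b hab)]

theorem interior_region_inter [Finite Λ] (hG : ∀ a b, G a b → a ≠ b) {W : Set E4}
    (hW : W.Finite) {D E : Set Λ} (hD : D ∈ 𝓓) (hE : E ∈ 𝓓) (hDE : Disjoint D E)
    (hne : D.Nonempty) :
    ∀ᶠ ε in 𝓝[>] (0 : ℝ), interior (C.region G W ε D) ∩ C.region G W ε E = ∅ := by
  obtain ⟨t, h1, h2, h3, h4⟩ := C.weak D hD E hE hDE
  have k2 := C.weak_half_region hG hW (t := -t) (by simpa using h2) fun b hb x hx => by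
    refine (h4 b hb x hx).imp (fun h => by simpa using h) ?_
    rintro ⟨h, c, rfl⟩
    exact ⟨h, -c, by simp⟩
  filter_upwards [C.weak_half_region hG hW h1 h3, k2] with ε k1 k2
  obtain ⟨a, ha⟩ := hne
  rw [Set.eq_empty_iff_forall_notMem]
  rintro x ⟨hx, hx'⟩
  have := Aff4.pos_of_mem_interior k1 (h1 a ha) hx
  have := k2 x hx'
  simp only [AffineMap.coe_neg, Pi.neg_apply] at this
  linarith

theorem strict_half_region [Finite Λ] (hG : ∀ a b, G a b → a ≠ b) {W : Set E4} (hW : W.Finite)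
    {D E : Set Λ} (hDE : Disjoint D E) (hno : ∀ a ∈ D, ∀ b ∈ E, ¬ G a b) {g : Aff4}
    (h1 : ∀ a ∈ D, 0 < g (C.q a))
    (h2 : ∀ a ∈ D, ∀ x ∉ E, a ≠ x → 0 < g (C.p a x)) :
    ∀ᶠ ε in 𝓝[>] (0 : ℝ), ∀ x ∈ C.region G W ε D, 0 < g x := by
  have hc : ∀ z ∈ C.core G D, 0 < g z := by
    rintro _ (⟨a, ha, rfl⟩ | ⟨a, ha, b, hb, hab, rfl⟩)
    · exact h1 a ha
    · exact h2 a ha b (Set.disjoint_left.1 hDE hb) (hG a b hab)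
  filter_upwards [Aff4.eventually_pos hW (C.finite_core D) D.ncard hc] with ε hε
  refine Aff4.pos_on_body hε ?_
  rintro _ ⟨a, ha, b, -, hab, rfl⟩
  exact h2 a ha b (fun hb => hno a ha b hb hab) (hG a b hab)

theorem region_inter_eq_empty [Finite Λ] (hG : ∀ a b, G a b → a ≠ b)
    (hGs : ∀ a b, G a b → G b a) {W : Set E4}
    (hW : W.Finite) {D E : Set Λ} (hD : D ∈ 𝓓) (hE : E ∈ 𝓓) (hDE : Disjoint D E)
    (hno : ∀ a ∈ D, ∀ b ∈ E, ¬ G a b) :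
    ∀ᶠ ε in 𝓝[>] (0 : ℝ), C.region G W ε D ∩ C.region G W ε E = ∅ := by
  obtain ⟨g, h1, h2, h3, h4, -⟩ := C.strict D hD E hE hDE
  have k2 := C.strict_half_region hG hW hDE.symm (fun b hb a ha h => hno a ha b hb (hGs _ _ h))
    (g := -g) (by simpa using h2) (by simpa using h4)
  filter_upwards [C.strict_half_region hG hW hDE hno h1 h3, k2] with ε k1 k2
  rw [Set.eq_empty_iff_forall_notMem]
  rintro x ⟨hx, hx'⟩
  have := k1 x hx
  have := k2 x hx'
  simp only [AffineMap.coe_neg, Pi.neg_apply] at this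
  linarith

theorem p_mem_region {W : Set E4} (hW : 0 ∈ interior (convexHull ℝ W)) {ε : ℝ} {D : Set Λ}
    (hε : 0 < ε * D.ncard) {a b : Λ} (ha : a ∈ D) (hab : G a b) : C.p a b ∈ C.region G W ε D := by
  by_cases hb : b ∈ D
  · exact interior_subset (mem_interior_body hW hε (.inr ⟨a, ha, b, hb, hab, rfl⟩))
  · exact subset_convexHull ℝ _ (.inr ⟨a, ha, b, hb, hab, rfl⟩)

end ContactSystem

theorem Laminar.exists_regions [Finite Λ] (h𝓓 : Laminar 𝓓) {G : Λ → Λ → Prop}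
    (hG : ∀ a b, G a b → a ≠ b) (hGs : ∀ a b, G a b → G b a) :
    ∃ B : Set Λ → Set E4,
      (∀ D ∈ 𝓓, (interior (B D)).Nonempty ∧ Convex ℝ (B D) ∧ RegClosed (B D)) ∧
      (∀ D ∈ 𝓓, ∀ E ∈ 𝓓, D ⊆ E → B D ⊆ B E) ∧
      (∀ D ∈ 𝓓, ∀ E ∈ 𝓓, D ⊂ E → (∀ a ∈ D, ∀ b, G a b → b ∈ E) → B D ⊆ interior (B E)) ∧
      (∀ D ∈ 𝓓, ∀ E ∈ 𝓓, Disjoint D E → interior (B D) ∩ B E = ∅) ∧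
      (∀ D ∈ 𝓓, ∀ E ∈ 𝓓, Disjoint D E → (∀ a ∈ D, ∀ b ∈ E, ¬ G a b) → B D ∩ B E = ∅) ∧
      (∀ D ∈ 𝓓, ∀ E ∈ 𝓓, ∀ a ∈ D, ∀ b ∈ E, G a b → (B D ∩ B E).Nonempty) := by
  obtain ⟨C⟩ := Laminar.nonempty_contactSystem (Nat.card Λ) le_rfl h𝓓
  obtain ⟨W, hWf, hW⟩ : ∃ W : Set E4, W.Finite ∧ 0 ∈ interior (convexHull ℝ W) := by
    obtain ⟨b, hb, -⟩ := exists_mem_interior_convexHull_affineBasis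
      (Filter.univ_mem : (Set.univ : Set E4) ∈ 𝓝 0)
    exact ⟨_, Set.finite_range b, hb⟩
  have k1 : ∀ᶠ ε in 𝓝[>] (0 : ℝ), ∀ D, D ∈ 𝓓 → ∀ E, E ∈ 𝓓 → Disjoint D E →
      interior (C.region G W ε D) ∩ C.region G W ε E = ∅ := by
    simp only [eventually_all]
    exact fun D hD E hE hDE => C.interior_region_inter hG hWf hD hE hDE (h𝓓.1 D hD)
  have k2 : ∀ᶠ ε in 𝓝[>] (0 : ℝ), ∀ D, D ∈ 𝓓 → ∀ E, E ∈ 𝓓 → Disjoint D E →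
      (∀ a ∈ D, ∀ b ∈ E, ¬ G a b) → C.region G W ε D ∩ C.region G W ε E = ∅ := by
    simp only [eventually_all]
    exact fun D hD E hE hDE hno => C.region_inter_eq_empty hG hGs hWf hD hE hDE hno
  obtain ⟨ε, k1, k2, hε⟩ := (k1.and (k2.and self_mem_nhdsWithin)).exists
  replace hε : 0 < ε := hε
  have hpos : ∀ D ∈ 𝓓, 0 < ε * D.ncard := fun D hD =>
    mul_pos hε (by exact_mod_cast (Set.ncard_pos (Set.toFinite D)).2 (h𝓓.1 D hD))
  have hcore : ∀ D ∈ 𝓓, (C.core G D).Nonempty := fun D hD =>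
    (h𝓓.1 D hD).elim fun a ha => ⟨C.q a, .inl ⟨a, ha, rfl⟩⟩
  refine ⟨C.region G W ε, fun D hD => ⟨?_, convex_convexHull ℝ _, ?_⟩, fun D hD E hE hDE => ?_,
    fun D hD E hE hDE hab => ?_, fun D hD E hE => k1 D hD E hE, fun D hD E hE => k2 D hD E hE,
    fun D hD E hE a ha b hb hab => ⟨C.p a b, C.p_mem_region hW (hpos D hD) ha hab, ?_⟩⟩
  · exact (hcore D hD).elim fun c hc => ⟨c, mem_interior_body hW (hpos D hD) hc⟩
  · exact regClosed_body hW (hpos D hD) hWf (C.finite_core D) (C.finite_tips D) (hcore D hD)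
  · refine body_subset hW (hpos D hD) ?_ (C.core_mono hDE) (C.tips_subset hDE)
    have := Set.ncard_le_ncard hDE
    gcongr
  · refine body_subset_interior hW (hpos D hD) ?_ (C.core_mono hDE.subset) ?_
    · have := Set.ncard_lt_ncard hDE
      gcongr
    · rintro _ ⟨a, ha, b, -, h, rfl⟩
      exact .inr ⟨a, hDE.subset ha, b, hab a ha b h, h, rfl⟩
  · rw [C.p_symm]
    exact C.p_mem_region hW (hpos E hE) hb (hGs _ _ hab)

end Region

section Network

theorem RegClosed.interior_inter_nonempty {X : Type*} [TopologicalSpace X] {s t : Set X}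
    (hs : RegClosed s) (h : (s ∩ interior t).Nonempty) : (interior s ∩ interior t).Nonempty := by
  rw [← hs] at h
  exact (closure_inter_open_nonempty_iff isOpen_interior).1 h

theorem RegClosed.interior_nonempty_s15 {X : Type*} [TopologicalSpace X] {s : Set X}
    (hs : RegClosed s) (h : s.Nonempty) : (interior s).Nonempty := by
  rw [← hs] at h
  exact closure_nonempty_iff.1 h

theorem NTPP.ssubset {X : Type*} [TopologicalSpace X] {s t : Set X} (h : NTPP s t) : s ⊂ t :=
  (h.1.trans interior_subset).ssubset_of_ne h.2

theorem relations_iff {X Y : Type*} [TopologicalSpace X] [TopologicalSpace Y] {s t : Set X}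
    {s' t' : Set Y} (hs : (interior s').Nonempty) (ht : (interior t').Nonempty)
    (h : EC s t ∨ DC s t ∨ TPP s t ∨ TPP t s ∨ NTPP s t ∨ NTPP t s)
    (hEC : EC s t → EC s' t') (hDC : DC s t → DC s' t') (hTPP : TPP s t → TPP s' t')
    (hTPP' : TPP t s → TPP t' s') (hNTPP : NTPP s t → NTPP s' t')
    (hNTPP' : NTPP t s → NTPP t' s') :
    (EC s' t' ↔ EC s t) ∧ (DC s' t' ↔ DC s t) ∧ (TPP s' t' ↔ TPP s t) ∧
      (NTPP s' t' ↔ NTPP s t) := by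
  have e1 : EC s' t' → ¬ DC s' t' := fun h h' => h.1.ne_empty h'
  have e2 : EC s' t' → ¬ s' ⊂ t' := fun h h' => by
    have := h.2
    rw [Set.inter_eq_left.2 (interior_mono h'.subset)] at this
    exact hs.ne_empty this
  have e3 : EC s' t' → ¬ t' ⊂ s' := fun h h' => by
    have := h.2
    rw [Set.inter_eq_right.2 (interior_mono h'.subset)] at this
    exact ht.ne_empty this
  have e4 : DC s' t' → ¬ s' ⊂ t' := fun h h' =>
    (hs.mono interior_subset).ne_empty ((Set.inter_eq_left.2 h'.subset).symm.trans h)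
  have e5 : DC s' t' → ¬ t' ⊂ s' := fun h h' =>
    (ht.mono interior_subset).ne_empty ((Set.inter_eq_right.2 h'.subset).symm.trans h)
  have e6 : s' ⊂ t' → ¬ t' ⊂ s' := fun h h' => h.not_subset h'.subset
  have e7 : TPP s' t' → s' ⊂ t' := fun h => h.1
  have e8 : TPP t' s' → t' ⊂ s' := fun h => h.1
  have e9 : NTPP s' t' → s' ⊂ t' := NTPP.ssubset
  have e10 : NTPP t' s' → t' ⊂ s' := NTPP.ssubset
  have e11 : TPP s' t' → ¬ NTPP s' t' := fun h h' => h.2 h'.1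
  refine ⟨⟨fun k => ?_, hEC⟩, ⟨fun k => ?_, hDC⟩, ⟨fun k => ?_, hTPP⟩, ⟨fun k => ?_, hNTPP⟩⟩ <;>
    rcases h with h | h | h | h | h | h <;> first | exact h | exfalso
  all_goals grind

variable {ι X : Type} [TopologicalSpace X] (A : ι → Set X)

/-- The nodes `k` with `A k ⊆ A i`, and the nodes `(k, l)` recording a tangential inclusion of `A k`
in `A l` with `A l` properly inside `A i`. -/
def nodesIn (i : ι) : Set (ι ⊕ ι × ι) :=
  {x | x.elim (fun k => A k ⊆ A i) fun e => TPP (A e.1) (A e.2) ∧ A e.2 ⊂ A i}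

/-- The contacts to be realised: external contacts, and a contact of `k` with every `(k, l)`
recording a tangential inclusion of `A k` in `A l`. -/
def Touches : ι ⊕ ι × ι → ι ⊕ ι × ι → Prop
  | .inl k, .inl l => EC (A k) (A l)
  | .inl k, .inr e => k = e.1 ∧ TPP (A e.1) (A e.2)
  | .inr e, .inl k => k = e.1 ∧ TPP (A e.1) (A e.2)
  | .inr _, .inr _ => False

variable {A}

theorem Touches.symm {x y : ι ⊕ ι × ι} (h : Touches A x y) : Touches A y x := by
  rcases x with k | e <;> rcases y with l | f
  · exact ⟨by rw [Set.inter_comm]; exact h.1, by rw [Set.inter_comm]; exact h.2⟩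
  all_goals exact h

theorem Touches.ne (hA : ∀ i, (A i).Nonempty ∧ RegClosed (A i)) {x y : ι ⊕ ι × ι}
    (h : Touches A x y) : x ≠ y := by
  rintro rfl
  rcases x with k | e
  · have h2 := h.2
    rw [Set.inter_self] at h2
    exact ((hA k).2.interior_nonempty_s15 (hA k).1).ne_empty h2
  · exact h

theorem nodesIn_mono {i j : ι} (h : A i ⊆ A j) : nodesIn A i ⊆ nodesIn A j := by
  rintro (k | e) hx
  · exact Set.Subset.trans hx h
  · exact ⟨hx.1, hx.2.trans_subset h⟩

theorem exists_subset_of_mem_nodesIn {x : ι ⊕ ι × ι} :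
    ∃ k, ∀ i, x ∈ nodesIn A i → A k ⊆ A i := by
  rcases x with k | e
  exacts [⟨k, fun i hx => hx⟩, ⟨e.2, fun i hx => hx.2.subset⟩]

theorem disjoint_nodesIn (hA : ∀ i, (A i).Nonempty ∧ RegClosed (A i)) {i j : ι}
    (h : interior (A i) ∩ interior (A j) = ∅) : Disjoint (nodesIn A i) (nodesIn A j) := by
  rw [Set.disjoint_left]
  intro x hx hx'
  obtain ⟨k, hk⟩ := exists_subset_of_mem_nodesIn (A := A) (x := x)
  obtain ⟨z, hz⟩ := (hA k).2.interior_nonempty_s15 (hA k).1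
  have : z ∈ interior (A i) ∩ interior (A j) :=
    ⟨interior_mono (hk i hx) hz, interior_mono (hk j hx') hz⟩
  simp [h] at this

theorem subset_or_ssubset
    (hrel : ∀ i j, i ≠ j → EC (A i) (A j) ∨ DC (A i) (A j) ∨ TPP (A i) (A j) ∨ TPP (A j) (A i) ∨
      NTPP (A i) (A j) ∨ NTPP (A j) (A i))
    {i j : ι} (h : (interior (A i) ∩ interior (A j)).Nonempty) :
    A i ⊆ A j ∨ A j ⊂ A i := by
  by_cases hij : i = j
  · exact .inl (hij ▸ subset_rfl)
  rcases hrel i j hij with h' | h' | h' | h' | h' | h'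
  · exact absurd h'.2 h.ne_empty
  · exact absurd h' (h.mono (Set.inter_subset_inter interior_subset interior_subset)).ne_empty
  · exact .inl h'.1.subset
  · exact .inr h'.1
  · exact .inl h'.ssubset.subset
  · exact .inr h'.ssubset

theorem laminar_range_nodesIn (hA : ∀ i, (A i).Nonempty ∧ RegClosed (A i))
    (hrel : ∀ i j, i ≠ j → EC (A i) (A j) ∨ DC (A i) (A j) ∨ TPP (A i) (A j) ∨ TPP (A j) (A i) ∨
      NTPP (A i) (A j) ∨ NTPP (A j) (A i)) :
    Laminar (Set.range (nodesIn A)) := by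
  constructor
  · rintro _ ⟨i, rfl⟩
    exact ⟨.inl i, (subset_rfl : A i ⊆ A i)⟩
  · rintro _ ⟨i, rfl⟩ _ ⟨j, rfl⟩
    rcases Set.eq_empty_or_nonempty (interior (A i) ∩ interior (A j)) with h | h
    · exact .inr (.inr (disjoint_nodesIn hA h))
    · exact (subset_or_ssubset hrel h).imp nodesIn_mono fun h => .inl (nodesIn_mono h.subset)

theorem mem_nodesIn_of_touches (hA : ∀ i, (A i).Nonempty ∧ RegClosed (A i))
    (hrel : ∀ i j, i ≠ j → EC (A i) (A j) ∨ DC (A i) (A j) ∨ TPP (A i) (A j) ∨ TPP (A j) (A i) ∨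
      NTPP (A i) (A j) ∨ NTPP (A j) (A i))
    {i j : ι} (h : A i ⊆ interior (A j)) {x y : ι ⊕ ι × ι}
    (hx : x ∈ nodesIn A i) (hxy : Touches A x y) : y ∈ nodesIn A j := by
  have key : ∀ k l, A k ⊆ A i → (A k ∩ A l).Nonempty → A l ⊆ A j ∨ A j ⊂ A l := by
    rintro k l hk ⟨z, hz, hz'⟩
    exact subset_or_ssubset hrel ((hA l).2.interior_inter_nonempty ⟨z, hz', h (hk hz)⟩)
  rcases x with k | e <;> rcases y with l | f
  · refine (key k l hx hxy.1).resolve_right fun hjl => ?_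
    obtain ⟨z, hz⟩ := (hA k).2.interior_nonempty_s15 (hA k).1
    have : z ∈ interior (A k) ∩ interior (A l) := ⟨hz, interior_mono
      ((Set.Subset.trans hx (h.trans interior_subset)).trans hjl.subset) hz⟩
    rw [hxy.2] at this
    exact this
  · obtain ⟨rfl, hT⟩ := hxy
    have hne : (A f.1 ∩ A f.2).Nonempty := by
      rw [Set.inter_eq_left.2 hT.1.subset]
      exact (hA _).1
    have hnot : ¬ A j ⊆ A f.2 := fun hj => hT.2 ((Set.Subset.trans hx h).trans (interior_mono hj))
    refine ⟨hT, ?_⟩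
    rcases key f.1 f.2 hx hne with h' | h'
    · exact ⟨h', hnot⟩
    · exact absurd h'.subset hnot
  · obtain ⟨rfl, hT⟩ := hxy
    exact hT.1.subset.trans (hx.2.subset.trans (h.trans interior_subset))
  · exact hxy.elim

theorem not_touches (hA : ∀ i, (A i).Nonempty ∧ RegClosed (A i)) {i j : ι}
    (h : DC (A i) (A j)) {x y : ι ⊕ ι × ι}
    (hx : x ∈ nodesIn A i) (hy : y ∈ nodesIn A j) : ¬ Touches A x y := by
  have key : ∀ k l, A k ⊆ A i → A l ⊆ A j → (A k ∩ A l) = ∅ := fun k l hk hl =>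
    Set.subset_empty_iff.1 ((Set.inter_subset_inter hk hl).trans h.subset)
  rcases x with k | e <;> rcases y with l | f <;> intro hxy
  · exact hxy.1.ne_empty (key k l hx hy)
  · obtain ⟨rfl, hT⟩ := hxy
    have := key f.1 f.2 hx hy.2.subset
    rw [Set.inter_eq_left.2 hT.1.subset] at this
    exact (hA _).1.ne_empty this
  · obtain ⟨rfl, hT⟩ := hxy
    have := key e.2 e.1 hx.2.subset hy
    rw [Set.inter_eq_right.2 hT.1.subset] at this
    exact (hA _).1.ne_empty this
  · exact hxy

end Network

/-- Every consistent atomic RCC8 network over {EC, DC, TPP, TPP⁻¹, NTPP, NTPP⁻¹}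
(i.e. not using PO) has a convex solution in ℝ⁴. -/
theorem statement15 (m d : ℕ) (A : Fin m → Set (EuclideanSpace ℝ (Fin d)))
    (hA : ∀ i, (A i).Nonempty ∧ RegClosed (A i))
    (hrel : ∀ i j : Fin m, i ≠ j →
      EC (A i) (A j) ∨ DC (A i) (A j) ∨ TPP (A i) (A j) ∨ TPP (A j) (A i) ∨
      NTPP (A i) (A j) ∨ NTPP (A j) (A i)) :
    ∃ B : Fin m → Set (EuclideanSpace ℝ (Fin 4)),
      (∀ i, (B i).Nonempty ∧ Convex ℝ (B i) ∧ RegClosed (B i)) ∧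
      (∀ i j : Fin m, i ≠ j →
        (EC (B i) (B j) ↔ EC (A i) (A j)) ∧
        (DC (B i) (B j) ↔ DC (A i) (A j)) ∧
        (TPP (B i) (B j) ↔ TPP (A i) (A j)) ∧
        (NTPP (B i) (B j) ↔ NTPP (A i) (A j))) := by
  obtain ⟨R, hR, hmono, hinter, hdisj, hempty, hmeet⟩ :=
    (laminar_range_nodesIn hA hrel).union_singletons.exists_regions
      (fun _ _ => Touches.ne hA) (fun _ _ => Touches.symm)
  have hmem : ∀ i, nodesIn A i ∈ Set.range (nodesIn A) ∪ {D | ∃ b, D = {b}} :=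
    fun i => .inl ⟨i, rfl⟩
  have hsing : ∀ b, {b} ∈ Set.range (nodesIn A) ∪ {D | ∃ b, D = {b}} := fun b => .inr ⟨b, rfl⟩
  have hself : ∀ i, .inl i ∈ nodesIn A i := fun i => (subset_rfl : A i ⊆ A i)
  have hEC : ∀ i j, EC (A i) (A j) → EC (R (nodesIn A i)) (R (nodesIn A j)) := fun i j h =>
    ⟨hmeet _ (hmem i) _ (hmem j) (.inl i) (hself i) (.inl j) (hself j) h,
      Set.subset_empty_iff.1 ((Set.inter_subset_inter_right _ interior_subset).trans
        (hdisj _ (hmem i) _ (hmem j) (disjoint_nodesIn hA h.2)).subset)⟩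
  have hDC : ∀ i j, DC (A i) (A j) → DC (R (nodesIn A i)) (R (nodesIn A j)) := fun i j h =>
    hempty _ (hmem i) _ (hmem j)
      (disjoint_nodesIn hA (Set.subset_empty_iff.1
        ((Set.inter_subset_inter interior_subset interior_subset).trans h.subset)))
      fun x hx y hy => not_touches hA h hx hy
  have hss : ∀ i j, A i ⊂ A j → R (nodesIn A i) ⊂ R (nodesIn A j) := by
    refine fun i j h => ⟨hmono _ (hmem i) _ (hmem j) (nodesIn_mono h.subset), fun hle => ?_⟩
    have hd : Disjoint {.inl j} (nodesIn A i) :=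
      Set.disjoint_singleton_left.2 fun hj => h.not_subset hj
    obtain ⟨z, hz⟩ := (hR _ (hsing (.inl j))).1
    have hzi : z ∈ R (nodesIn A i) := hle (hmono _ (hsing _) _ (hmem j)
      (Set.singleton_subset_iff.2 (hself j)) (interior_subset hz))
    exact Set.eq_empty_iff_forall_notMem.1 (hdisj _ (hsing _) _ (hmem i) hd) z ⟨hz, hzi⟩
  have hTPP : ∀ i j, TPP (A i) (A j) → TPP (R (nodesIn A i)) (R (nodesIn A j)) := by
    refine fun i j h => ⟨hss i j h.1, fun hle => ?_⟩
    obtain ⟨z, hz, hz'⟩ := hmeet _ (hmem i) _ (hsing (.inr (i, j))) (.inl i) (hself i)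
      (.inr (i, j)) rfl ⟨rfl, h⟩
    have hd : Disjoint (nodesIn A j) {.inr (i, j)} :=
      Set.disjoint_singleton_right.2 fun hj => hj.2.not_subset subset_rfl
    exact Set.eq_empty_iff_forall_notMem.1 (hdisj _ (hmem j) _ (hsing _) hd) z ⟨hle hz, hz'⟩
  have hNTPP : ∀ i j, NTPP (A i) (A j) → NTPP (R (nodesIn A i)) (R (nodesIn A j)) := by
    refine fun i j h => ⟨hinter _ (hmem i) _ (hmem j) ⟨nodesIn_mono h.ssubset.subset, fun hle => ?_⟩
      fun x hx y hxy => mem_nodesIn_of_touches hA hrel h.1 hx hxy, (hss i j h.ssubset).ne⟩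
    exact h.ssubset.not_subset (hle (hself j))
  refine ⟨fun i => R (nodesIn A i), fun i => ?_, fun i j hij => ?_⟩
  · obtain ⟨h1, h2, h3⟩ := hR _ (hmem i)
    exact ⟨h1.mono interior_subset, h2, h3⟩
  · exact relations_iff (hR _ (hmem i)).1 (hR _ (hmem j)).1 (hrel i j hij) (hEC i j) (hDC i j)
      (hTPP i j) (hTPP j i) (hNTPP i j) (hNTPP j i)
end

section
/- Let m₁ < t₁ < t₂ < m₂ be real numbers. Then there exist real coefficients a, b, c, d and θ, not all of a, b, c, d zero, such that the function f : ℝ → ℝ defined by f(t) = a·t + b·t² + c·t³ + d·t⁴ − θ satisfies f(t₁) = 0 and f(t₂) = 0, has vanishing derivative at m₁ and at m₂, and attains a local extremum at m₁ and at m₂. (Equivalently: there is a hyperplane H = {x ∈ ℝ⁴ : h·x = θ} through the points M(t₁) and M(t₂) of the four-dimensional moment curve M(t) = (t, t², t³, t⁴) such that t ↦ h·M(t) − θ has local extrema at m₁ and m₂.) -/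
theorem hasDerivAt_quartic (a b c d θ t : ℝ) :
    HasDerivAt (fun t : ℝ => a * t + b * t ^ 2 + c * t ^ 3 + d * t ^ 4 - θ)
      (a + 2 * b * t + 3 * c * t ^ 2 + 4 * d * t ^ 3) t := by
  have h := (((((hasDerivAt_id t).const_mul a).add ((hasDerivAt_pow 2 t).const_mul b)).add
    ((hasDerivAt_pow 3 t).const_mul c)).add ((hasDerivAt_pow 4 t).const_mul d)).sub_const θ
  refine h.congr_deriv ?_
  push_cast
  ring

/-- The second-derivative test for a quartic polynomial. -/
theorem isLocalMin_quartic {a b c d θ m : ℝ}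
    (h₁ : a + 2 * b * m + 3 * c * m ^ 2 + 4 * d * m ^ 3 = 0)
    (h₂ : 0 < 2 * b + 6 * c * m + 12 * d * m ^ 2) :
    IsLocalMin (fun t : ℝ => a * t + b * t ^ 2 + c * t ^ 3 + d * t ^ 4 - θ) m := by
  have hd : deriv (fun t : ℝ => a * t + b * t ^ 2 + c * t ^ 3 + d * t ^ 4 - θ) =
      fun t => (2 * b) * t + (3 * c) * t ^ 2 + (4 * d) * t ^ 3 + 0 * t ^ 4 - (-a) := by
    funext t
    rw [(hasDerivAt_quartic a b c d θ t).deriv]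
    ring
  refine isLocalMin_of_deriv_deriv_pos ?_ ?_ (hasDerivAt_quartic a b c d θ m).continuousAt
  · rw [hd, (hasDerivAt_quartic _ _ _ _ _ m).deriv]
    linarith
  · rw [(hasDerivAt_quartic a b c d θ m).deriv, h₁]

/-- The increment from `t₁` to `t₂` of the antiderivative of `12 (t - m₁) (t - m₂) (t - r)`
vanishes for some `r` between `t₁` and `t₂`. -/
theorem exists_root_quartic_increment_eq_zero {m₁ t₁ t₂ m₂ : ℝ}
    (h₁ : m₁ < t₁) (h₂ : t₁ < t₂) (h₃ : t₂ < m₂) :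
    ∃ r ∈ Set.Icc t₁ t₂,
      -12 * m₁ * m₂ * r * (t₂ - t₁) + 6 * (m₁ * m₂ + r * (m₁ + m₂)) * (t₂ ^ 2 - t₁ ^ 2) +
        -4 * (m₁ + m₂ + r) * (t₂ ^ 3 - t₁ ^ 3) + 3 * (t₂ ^ 4 - t₁ ^ 4) = 0 := by
  refine intermediate_value_Icc h₂.le (f := fun r : ℝ =>
    -12 * m₁ * m₂ * r * (t₂ - t₁) + 6 * (m₁ * m₂ + r * (m₁ + m₂)) * (t₂ ^ 2 - t₁ ^ 2) +
      -4 * (m₁ + m₂ + r) * (t₂ ^ 3 - t₁ ^ 3) + 3 * (t₂ ^ 4 - t₁ ^ 4))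
    (by fun_prop) ?_
  obtain ⟨u, hu, rfl⟩ : ∃ u, 0 < u ∧ t₁ = m₁ + u := ⟨t₁ - m₁, by linarith, by ring⟩
  obtain ⟨h, hh, rfl⟩ : ∃ h, 0 < h ∧ t₂ = m₁ + u + h :=
    ⟨t₂ - (m₁ + u), by linarith, by ring⟩
  obtain ⟨v, hv, rfl⟩ : ∃ v, 0 < v ∧ m₂ = m₁ + u + h + v :=
    ⟨m₂ - (m₁ + u + h), by linarith, by ring⟩
  constructor
  · have : 0 ≤ 2 * u * h ^ 3 + 6 * u * v * h ^ 2 + h ^ 4 + 4 * v * h ^ 3 := by positivity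
    linear_combination this
  · have : 0 ≤ 2 * v * h ^ 3 + 6 * u * v * h ^ 2 + h ^ 4 + 4 * u * h ^ 3 := by positivity
    linear_combination this


/-- Lemma 1 of the paper: for m₁ < t₁ < t₂ < m₂ there is a quartic
f(t) = a·t + b·t² + c·t³ + d·t⁴ − θ (with (a,b,c,d) ≠ 0) vanishing at t₁ and t₂,
with vanishing derivative and a local extremum at m₁ and at m₂. -/
theorem statement19 (m₁ t₁ t₂ m₂ : ℝ) (h₁ : m₁ < t₁) (h₂ : t₁ < t₂) (h₃ : t₂ < m₂) :
    ∃ a b c d θ : ℝ, ¬ (a = 0 ∧ b = 0 ∧ c = 0 ∧ d = 0) ∧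
      a * t₁ + b * t₁ ^ 2 + c * t₁ ^ 3 + d * t₁ ^ 4 - θ = 0 ∧
      a * t₂ + b * t₂ ^ 2 + c * t₂ ^ 3 + d * t₂ ^ 4 - θ = 0 ∧
      deriv (fun t : ℝ => a * t + b * t ^ 2 + c * t ^ 3 + d * t ^ 4 - θ) m₁ = 0 ∧
      deriv (fun t : ℝ => a * t + b * t ^ 2 + c * t ^ 3 + d * t ^ 4 - θ) m₂ = 0 ∧
      IsLocalExtr (fun t : ℝ => a * t + b * t ^ 2 + c * t ^ 3 + d * t ^ 4 - θ) m₁ ∧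
      IsLocalExtr (fun t : ℝ => a * t + b * t ^ 2 + c * t ^ 3 + d * t ^ 4 - θ) m₂ := by
  obtain ⟨r, ⟨hr₁, hr₂⟩, hr⟩ := exists_root_quartic_increment_eq_zero h₁ h₂ h₃
  have hpos₁ : 0 < (m₂ - m₁) * (r - m₁) := mul_pos (by linarith) (by linarith)
  have hpos₂ : 0 < (m₂ - m₁) * (m₂ - r) := mul_pos (by linarith) (by linarith)
  refine ⟨-12 * m₁ * m₂ * r, 6 * (m₁ * m₂ + r * (m₁ + m₂)), -4 * (m₁ + m₂ + r), 3,
    -12 * m₁ * m₂ * r * t₁ + 6 * (m₁ * m₂ + r * (m₁ + m₂)) * t₁ ^ 2 +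
      -4 * (m₁ + m₂ + r) * t₁ ^ 3 + 3 * t₁ ^ 4,
    by norm_num, by ring, by linear_combination hr, ?_, ?_, Or.inl ?_, Or.inl ?_⟩
  · rw [(hasDerivAt_quartic _ _ _ _ _ _).deriv]
    ring
  · rw [(hasDerivAt_quartic _ _ _ _ _ _).deriv]
    ring
  · exact isLocalMin_quartic (by ring) (by linear_combination 12 * hpos₁)
  · exact isLocalMin_quartic (by ring) (by linear_combination 12 * hpos₂)
end
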